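/- (The Cauchy operator is a homeomorphism.) Assume hypotheses (H1)–(H3) hold on every interval [0,T], T > 0, with all constants independent of T, let q0, q be chosen with 1 − 1/p < 1/q0 < min{β, δα, δ/p, 1/2} and 1/(q0·δ) ≤ 1/q < min{α, 1/p}, and let ω ∈ C̃^p(ℝ,ℝ^m). For −∞ < t_1 ≤ t_2 < +∞ define the Cauchy operator X(t_1,t_2,ω,·) : ℝ^d → ℝ^d by X(t_1,t_2,ω,x_{t_1}) := x_{t_2}, where x is the unique solution of finite q-variation of x_t = x_{t_1} + ∫_{t_1}^t f(s,x_s) ds + ∫_{t_1}^t g(s,x_s) dω_s on [t_1,t_2]. Then for all t_1 ≤ t_2 the Cauchy operator X(t_1,t_2,ω,·) is a homeomorphism of ℝ^d, and X(t_1,t_1,ω,·) is the identity map. -/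

import Mathlib

open scoped BigOperators
open Set

noncomputable section

/-- Euclidean space `ℝ^n`. -/
abbrev Ed (n : ℕ) : Type := EuclideanSpace ℝ (Fin n)

section PVarDefs

variable {E F : Type*} [NormedAddCommGroup E] [NormedSpace ℝ E]
  [NormedAddCommGroup F] [NormedSpace ℝ F]

/-- The set of sums `Σ_i ‖x (t (i+1)) - x (t i)‖ ^ p` over all finite partitions
`a = t 0 < t 1 < ⋯ < t n = b` of `[a,b]`. -/
def pVarSums (p : ℝ) (x : ℝ → E) (a b : ℝ) : Set ℝ :=
  { v | ∃ n : ℕ, ∃ t : Fin (n + 1) → ℝ, StrictMono t ∧ t 0 = a ∧ t (Fin.last n) = b ∧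
      v = ∑ i : Fin n, ‖x (t i.succ) - x (t i.castSucc)‖ ^ p }

/-- The `p`-variation seminorm `|||x|||_{p-var,[a,b]}`. -/
def pVar (p : ℝ) (x : ℝ → E) (a b : ℝ) : ℝ :=
  sSup (pVarSums p x a b) ^ (1 / p)

/-- `x` is of finite `p`-variation on `[a,b]`. -/
def FinitePVar (p : ℝ) (x : ℝ → E) (a b : ℝ) : Prop :=
  BddAbove (pVarSums p x a b)

/-- The `p`-variation norm `‖x‖_{p-var,[a,b]} = ‖x a‖ + |||x|||_{p-var,[a,b]}`. -/
def pVarNorm (p : ℝ) (x : ℝ → E) (a b : ℝ) : ℝ :=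
  ‖x a‖ + pVar p x a b

/-- A control function on `[a,b]`: continuous on the simplex, vanishing on the diagonal,
superadditive and nonnegative. -/
def IsControlOn (a b : ℝ) (w : ℝ → ℝ → ℝ) : Prop :=
  ContinuousOn (fun pr : ℝ × ℝ => w pr.1 pr.2) {pr : ℝ × ℝ | a ≤ pr.1 ∧ pr.1 ≤ pr.2 ∧ pr.2 ≤ b} ∧
  (∀ t : ℝ, a ≤ t → t ≤ b → w t t = 0) ∧
  (∀ s t u : ℝ, a ≤ s → s ≤ t → t ≤ u → u ≤ b → w s t + w t u ≤ w s u) ∧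
  (∀ s t : ℝ, a ≤ s → s ≤ t → t ≤ b → 0 ≤ w s t)

/-- A tagged partition `a = t 0 < t 1 < ⋯ < t n = b` of `[a,b]`, with tags
`tag i ∈ [t i, t (i+1)]`. -/
structure TaggedPartition (a b : ℝ) where
  n : ℕ
  t : Fin (n + 1) → ℝ
  tag : Fin n → ℝ
  mono : StrictMono t
  first : t 0 = a
  last : t (Fin.last n) = b
  tag_mem : ∀ i : Fin n, tag i ∈ Set.Icc (t i.castSucc) (t i.succ)

/-- The mesh of a tagged partition. -/
def TaggedPartition.mesh {a b : ℝ} (P : TaggedPartition a b) : ℝ :=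
  ⨆ i : Fin P.n, (P.t i.succ - P.t i.castSucc)

/-- Riemann–Stieltjes sum of `x` against `ω` along a tagged partition. -/
def RSSum (x : ℝ → E →L[ℝ] F) (ω : ℝ → E) {a b : ℝ} (P : TaggedPartition a b) : F :=
  ∑ i : Fin P.n, x (P.tag i) (ω (P.t i.succ) - ω (P.t i.castSucc))

/-- `v` is the Young integral `∫_a^b x dω`: the Riemann–Stieltjes sums converge to `v`
as the mesh tends to `0`. -/
def IsYoungIntegral (x : ℝ → E →L[ℝ] F) (ω : ℝ → E) (a b : ℝ) (v : F) : Prop :=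
  ∀ ε : ℝ, 0 < ε → ∃ δ : ℝ, 0 < δ ∧
    ∀ P : TaggedPartition a b, P.mesh < δ → ‖RSSum x ω P - v‖ < ε

/-- The Young integral `∫_a^b x dω` (an arbitrary value, `0`, if the limit does not exist). -/
def youngIntegral (x : ℝ → E →L[ℝ] F) (ω : ℝ → E) (a b : ℝ) : F :=
  letI := Classical.propDecidable (∃ v, IsYoungIntegral x ω a b v)
  if hv : ∃ v, IsYoungIntegral x ω a b v then hv.choose else 0

end PVarDefs

/-- A nonnegative superadditive function on the simplex `a ≤ s ≤ t ≤ b`. -/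
structure IsSuperadd (a b : ℝ) (W : ℝ → ℝ → ℝ) : Prop where
  nonneg : ∀ s t : ℝ, a ≤ s → s ≤ t → t ≤ b → 0 ≤ W s t
  superadd : ∀ s t u : ℝ, a ≤ s → s ≤ t → t ≤ u → u ≤ b → W s t + W t u ≤ W s u

/-- `W s t` tends to `0` uniformly as `t - s` tends to `0`. -/
def VanishesOnDiag (a b : ℝ) (W : ℝ → ℝ → ℝ) : Prop :=
  ∀ ε : ℝ, 0 < ε → ∃ η : ℝ, 0 < η ∧
    ∀ s t : ℝ, a ≤ s → s ≤ t → t ≤ b → t - s < η → W s t ≤ ε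

namespace IsSuperadd

variable {a b : ℝ} {W W' : ℝ → ℝ → ℝ}

theorem diag (hW : IsSuperadd a b W) {t : ℝ} (h1 : a ≤ t) (h2 : t ≤ b) : W t t = 0 := by
  have := hW.superadd t t t h1 le_rfl le_rfl h2
  have := hW.nonneg t t h1 le_rfl h2
  linarith

theorem mono (hW : IsSuperadd a b W) {s s' t' t : ℝ} (h1 : a ≤ s) (h2 : s ≤ s') (h3 : s' ≤ t')
    (h4 : t' ≤ t) (h5 : t ≤ b) : W s' t' ≤ W s t := by
  have e1 := hW.superadd s s' t' h1 h2 h3 (h4.trans h5)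
  have e2 := hW.superadd s t' t h1 (h2.trans h3) h4 h5
  have e3 := hW.nonneg s s' h1 h2 (h3.trans (h4.trans h5))
  have e4 := hW.nonneg t' t (h1.trans (h2.trans h3)) h4 h5
  linarith

theorem restrict (hW : IsSuperadd a b W) {c d : ℝ} (h1 : a ≤ c) (h2 : d ≤ b) :
    IsSuperadd c d W :=
  ⟨fun s t hs hst ht => hW.nonneg s t (h1.trans hs) hst (ht.trans h2),
   fun s t u hs hst htu hu => hW.superadd s t u (h1.trans hs) hst htu (hu.trans h2)⟩

theorem add (hW : IsSuperadd a b W) (hW' : IsSuperadd a b W') :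
    IsSuperadd a b (fun s t => W s t + W' s t) :=
  ⟨fun s t hs hst ht => add_nonneg (hW.nonneg s t hs hst ht) (hW'.nonneg s t hs hst ht),
   fun s t u hs hst htu hu => by
    have := hW.superadd s t u hs hst htu hu
    have := hW'.superadd s t u hs hst htu hu
    linarith⟩

theorem of_monotoneOn {v : ℝ → ℝ} (hv : MonotoneOn v (Icc a b)) :
    IsSuperadd a b (fun s t => v t - v s) :=
  ⟨fun s t hs hst ht => sub_nonneg.2 (hv ⟨hs, hst.trans ht⟩ ⟨hs.trans hst, ht⟩ hst),
   fun s t u _ _ _ _ => by simp⟩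

/-- The weighted geometric mean of two superadditive functions is superadditive. -/
theorem geom_mean (hW : IsSuperadd a b W) (hW' : IsSuperadd a b W') {x y : ℝ} (hx : 0 < x)
    (hy : 0 < y) (hxy : x + y = 1) : IsSuperadd a b (fun s t => W s t ^ x * W' s t ^ y) := by
  refine ⟨fun s t hs hst ht => mul_nonneg (Real.rpow_nonneg (hW.nonneg s t hs hst ht) _)
    (Real.rpow_nonneg (hW'.nonneg s t hs hst ht) _), fun s t u hs hst htu hu => ?_⟩
  have key : ∀ p q r k : ℝ, 0 ≤ p → 0 ≤ q → 0 ≤ r → 0 ≤ k →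
      p ^ x * r ^ y + q ^ x * k ^ y ≤ (p + q) ^ x * (r + k) ^ y := by
    intro p q r k hp hq hr hk
    rcases (add_nonneg hp hq).eq_or_lt with h0 | h0
    · have h1 : p = 0 := by linarith
      have h2 : q = 0 := by linarith
      simp [h1, h2, Real.zero_rpow hx.ne']
    rcases (add_nonneg hr hk).eq_or_lt with h0' | h0'
    · have h1 : r = 0 := by linarith
      have h2 : k = 0 := by linarith
      simp [h1, h2, Real.zero_rpow hy.ne']
    have e1 := Real.geom_mean_le_arith_mean2_weighted hx.le hy.le
      (div_nonneg hp h0.le) (div_nonneg hr h0'.le) hxy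
    have e2 := Real.geom_mean_le_arith_mean2_weighted hx.le hy.le
      (div_nonneg hq h0.le) (div_nonneg hk h0'.le) hxy
    have e3 : x * (p / (p + q)) + y * (r / (r + k)) + (x * (q / (p + q)) + y * (k / (r + k)))
        = 1 := by
      rw [← hxy]; field_simp; ring
    rw [Real.div_rpow hp h0.le, Real.div_rpow hr h0'.le] at e1
    rw [Real.div_rpow hq h0.le, Real.div_rpow hk h0'.le] at e2
    have hP := Real.rpow_pos_of_pos h0 x
    have hR := Real.rpow_pos_of_pos h0' y
    have e4 : (p ^ x * r ^ y + q ^ x * k ^ y) / ((p + q) ^ x * (r + k) ^ y) ≤ 1 := by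
      calc _ = p ^ x / (p + q) ^ x * (r ^ y / (r + k) ^ y)
            + q ^ x / (p + q) ^ x * (k ^ y / (r + k) ^ y) := by field_simp
        _ ≤ 1 := by linarith
    rwa [div_le_one (by positivity)] at e4
  have n1 := hW.nonneg s t hs hst (htu.trans hu)
  have n2 := hW.nonneg t u (hs.trans hst) htu hu
  have n3 := hW'.nonneg s t hs hst (htu.trans hu)
  have n4 := hW'.nonneg t u (hs.trans hst) htu hu
  refine (key _ _ _ _ n1 n2 n3 n4).trans ?_
  have m1 := hW.superadd s t u hs hst htu hu
  have m2 := hW'.superadd s t u hs hst htu hu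
  have n5 := hW.nonneg s u hs (hst.trans htu) hu
  gcongr

theorem sum_le (hW : IsSuperadd a b W) {u : ℕ → ℝ} (hu : Monotone u) (h0 : a ≤ u 0) :
    ∀ n : ℕ, u n ≤ b → ∑ i ∈ Finset.range n, W (u i) (u (i + 1)) ≤ W (u 0) (u n) := by
  intro n
  induction n with
  | zero => intro hb; simpa using hW.nonneg _ _ h0 le_rfl hb
  | succ n ih =>
    intro hb
    rw [Finset.sum_range_succ]
    have h1 := ih ((hu n.le_succ).trans hb)
    have h2 := hW.superadd (u 0) (u n) (u (n + 1)) h0 (hu n.zero_le) (hu n.le_succ) hb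
    linarith

end IsSuperadd

namespace VanishesOnDiag

variable {a b : ℝ} {W W' : ℝ → ℝ → ℝ}

theorem restrict (hW : VanishesOnDiag a b W) {c d : ℝ} (h1 : a ≤ c) (h2 : d ≤ b) :
    VanishesOnDiag c d W := by
  intro ε hε
  obtain ⟨η, hη, h⟩ := hW ε hε
  exact ⟨η, hη, fun s t hs hst ht => h s t (h1.trans hs) hst (ht.trans h2)⟩

theorem add (hW : VanishesOnDiag a b W) (hW' : VanishesOnDiag a b W') :
    VanishesOnDiag a b (fun s t => W s t + W' s t) := by
  intro ε hε
  obtain ⟨η, hη, h⟩ := hW (ε / 2) (by positivity)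
  obtain ⟨η', hη', h'⟩ := hW' (ε / 2) (by positivity)
  refine ⟨min η η', lt_min hη hη', fun s t hs hst ht hd => ?_⟩
  have e1 := h s t hs hst ht (hd.trans_le (min_le_left _ _))
  have e2 := h' s t hs hst ht (hd.trans_le (min_le_right _ _))
  simp only
  linarith

theorem of_continuousOn {v : ℝ → ℝ} (hv : ContinuousOn v (Icc a b)) :
    VanishesOnDiag a b (fun s t => v t - v s) := by
  intro ε hε
  have hu := isCompact_Icc.uniformContinuousOn_of_continuous hv
  obtain ⟨η, hη, h⟩ := Metric.uniformContinuousOn_iff.1 hu ε hε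
  refine ⟨η, hη, fun s t hs hst ht hd => ?_⟩
  have := h t ⟨hs.trans hst, ht⟩ s ⟨hs, hst.trans ht⟩
    (by rw [Real.dist_eq, abs_of_nonneg (by linarith)]; exact hd)
  rw [Real.dist_eq] at this
  exact (le_abs_self _).trans this.le

theorem const_mul_rpow (hW : IsSuperadd a b W) (hv : VanishesOnDiag a b W) {c e : ℝ}
    (hc : 0 ≤ c) (he : 0 < e) : VanishesOnDiag a b (fun s t => c * W s t ^ e) := by
  intro ε hε
  obtain ⟨η, hη, h⟩ := hv ((ε / (c + 1)) ^ (1 / e)) (by positivity)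
  refine ⟨η, hη, fun s t hs hst ht hd => ?_⟩
  have h1 := h s t hs hst ht hd
  have h2 : W s t ^ e ≤ ε / (c + 1) := by
    calc W s t ^ e ≤ ((ε / (c + 1)) ^ (1 / e)) ^ e :=
          Real.rpow_le_rpow (hW.nonneg s t hs hst ht) h1 he.le
      _ = ε / (c + 1) := by
          rw [← Real.rpow_mul (by positivity), one_div_mul_cancel he.ne', Real.rpow_one]
  have h3 : W s t ^ e * (c + 1) ≤ ε := (le_div_iff₀ (by positivity)).1 h2
  have h4 := Real.rpow_nonneg (hW.nonneg s t hs hst ht) e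
  simp only
  nlinarith

theorem rpow_le_mul (hW : IsSuperadd a b W) (hv : VanishesOnDiag a b W) {θ : ℝ} (hθ : 1 < θ)
    {ε : ℝ} (hε : 0 < ε) : ∃ η : ℝ, 0 < η ∧
    ∀ s t : ℝ, a ≤ s → s ≤ t → t ≤ b → t - s < η → W s t ^ θ ≤ ε * W s t := by
  obtain ⟨η, hη, h⟩ := const_mul_rpow hW hv zero_le_one (sub_pos.2 hθ) ε hε
  refine ⟨η, hη, fun s t hs hst ht hd => ?_⟩
  have h1 := h s t hs hst ht hd
  have h0 := hW.nonneg s t hs hst ht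
  simp only [one_mul] at h1
  rcases h0.eq_or_lt with h0 | h0
  · rw [← h0, Real.zero_rpow (by linarith)]; simp
  · have : W s t ^ θ = W s t ^ (θ - 1) * W s t := by
      rw [← Real.rpow_add_one h0.ne']; ring_nf
    rw [this]; gcongr

end VanishesOnDiag

theorem IsControlOn.isSuperadd {a b : ℝ} {h : ℝ → ℝ → ℝ} (hh : IsControlOn a b h) :
    IsSuperadd a b h := ⟨hh.2.2.2, hh.2.2.1⟩

theorem IsControlOn.vanishesOnDiag {a b : ℝ} {h : ℝ → ℝ → ℝ} (hh : IsControlOn a b h) :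
    VanishesOnDiag a b h := by
  intro ε hε
  have hK : IsCompact {pr : ℝ × ℝ | a ≤ pr.1 ∧ pr.1 ≤ pr.2 ∧ pr.2 ≤ b} := by
    refine (isCompact_Icc (a := (a, a)) (b := (b, b))).of_isClosed_subset ?_ ?_
    · exact (isClosed_le continuous_const continuous_fst).inter
        ((isClosed_le continuous_fst continuous_snd).inter
          (isClosed_le continuous_snd continuous_const))
    · rintro ⟨x, y⟩ ⟨h1, h2, h3⟩
      exact ⟨⟨h1, h1.trans h2⟩, ⟨h2.trans h3, h3⟩⟩
  have hu := hK.uniformContinuousOn_of_continuous hh.1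
  obtain ⟨η, hη, hd⟩ := Metric.uniformContinuousOn_iff.1 hu ε hε
  refine ⟨η, hη, fun s t hs hst ht hlt => ?_⟩
  have := hd (s, t) ⟨hs, hst, ht⟩ (s, s) ⟨hs, le_rfl, hst.trans ht⟩ (by
    rw [Prod.dist_eq, dist_self, Real.dist_eq]
    simp only
    rw [abs_of_nonneg (by linarith)]
    exact max_lt hη hlt)
  rw [Real.dist_eq, hh.2.1 s hs (hst.trans ht), sub_zero] at this
  exact (le_abs_self _).trans this.le
section Sewing

variable {F : Type*} [NormedAddCommGroup F]

/-- The constant of the sewing lemma. -/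
def sewConst (θ : ℝ) : ℝ := 2 / (1 - 2 * (1 / 2 : ℝ) ^ θ)

theorem two_mul_half_rpow_lt_one {θ : ℝ} (hθ : 1 < θ) : 2 * (1 / 2 : ℝ) ^ θ < 1 := by
  have : (1 / 2 : ℝ) ^ θ < (1 / 2 : ℝ) ^ (1 : ℝ) :=
    Real.rpow_lt_rpow_of_exponent_gt (by norm_num) (by norm_num) hθ
  rw [Real.rpow_one] at this
  linarith

theorem sewConst_pos {θ : ℝ} (hθ : 1 < θ) : 0 < sewConst θ :=
  div_pos two_pos (sub_pos.2 (two_mul_half_rpow_lt_one hθ))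

theorem sewConst_eq {θ : ℝ} (hθ : 1 < θ) :
    sewConst θ * (2 * (1 / 2 : ℝ) ^ θ) + 2 = sewConst θ := by
  have := sub_pos.2 (two_mul_half_rpow_lt_one hθ)
  unfold sewConst
  field_simp
  ring

theorem exists_finset_primitive (A : ℝ → ℝ → F) (S : Finset ℝ) :
    ∃ Φ : ℝ → F, ∀ s ∈ S, ∀ t ∈ S, s < t → (∀ r ∈ S, ¬(s < r ∧ r < t)) →
      Φ t - Φ s = A s t := by
  induction S using Finset.induction_on_max with
  | empty => exact ⟨0, by simp⟩
  | insert m S hm ih =>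
    obtain ⟨Φ, hΦ⟩ := ih
    rcases S.eq_empty_or_nonempty with rfl | hS
    · refine ⟨0, fun s hs t ht hst => ?_⟩
      simp only [insert_empty_eq, Finset.mem_singleton] at hs ht
      exact absurd hst (by rw [hs, ht]; exact lt_irrefl _)
    · refine ⟨Function.update Φ m (Φ (S.max' hS) + A (S.max' hS) m), fun s hs t ht hst hc => ?_⟩
      have hsm : s ≠ m := by
        rintro rfl
        rcases Finset.mem_insert.1 ht with rfl | h
        · exact lt_irrefl _ hst
        · exact lt_asymm hst (hm t h)
      have hs' : s ∈ S := (Finset.mem_insert.1 hs).resolve_left hsm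
      rw [Function.update_of_ne hsm]
      rcases Finset.mem_insert.1 ht with rfl | h
      · have : s = S.max' hS := by
          refine le_antisymm (S.le_max' s hs') (not_lt.1 fun hlt => ?_)
          exact hc _ (Finset.mem_insert_of_mem (S.max'_mem hS)) ⟨hlt, hm _ (S.max'_mem hS)⟩
        rw [Function.update_self, ← this]
        abel
      · rw [Function.update_of_ne (hm t h).ne]
        exact hΦ s hs' t h hst fun r hr => hc r (Finset.mem_insert_of_mem hr)

theorem finset_sewing_bound {a b : ℝ} {V : ℝ → ℝ → ℝ} (hV : IsSuperadd a b V) {θ C : ℝ}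
    (hθ : 1 < θ) (hC : 0 ≤ C) {A : ℝ → ℝ → F}
    (hA : ∀ u v w : ℝ, a ≤ u → u ≤ v → v ≤ w → w ≤ b →
      ‖A u w - A u v - A v w‖ ≤ C * V u w ^ θ)
    {S : Finset ℝ} (hS : ∀ s ∈ S, a ≤ s ∧ s ≤ b) {Φ : ℝ → F}
    (hΦ : ∀ s ∈ S, ∀ t ∈ S, s < t → (∀ r ∈ S, ¬(s < r ∧ r < t)) → Φ t - Φ s = A s t) :
    ∀ n : ℕ, ∀ s ∈ S, ∀ t ∈ S, s ≤ t → (S.filter fun r => s < r ∧ r ≤ t).card = n →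
      ‖Φ t - Φ s - A s t‖ ≤ sewConst θ * C * V s t ^ θ := by
  intro n
  induction n using Nat.strong_induction_on with
  | _ n ih =>
    intro s hs t ht hst hn
    have hK := sewConst_pos hθ
    have has := (hS s hs).1
    have htb := (hS t ht).2
    have hVst := hV.nonneg s t has hst htb
    rcases hst.eq_or_lt with rfl | hlt
    · have h1 := hA s s s has le_rfl le_rfl htb
      rw [hV.diag has htb, Real.zero_rpow (by linarith)] at h1 ⊢
      simpa using h1
    set T := S.filter fun r => s ≤ r ∧ r < t ∧ V s r ≤ V s t / 2 with hT
    have hTne : T.Nonempty := ⟨s, by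
      rw [hT, Finset.mem_filter, hV.diag has (hst.trans htb)]
      exact ⟨hs, le_rfl, hlt, by positivity⟩⟩
    set u := T.max' hTne
    obtain ⟨huS, hsu, hut, hVu⟩ := Finset.mem_filter.1 (T.max'_mem hTne)
    set T' := S.filter fun r => u < r ∧ r ≤ t with hT'
    have hTne' : T'.Nonempty := ⟨t, by
      rw [hT', Finset.mem_filter]; exact ⟨ht, hut, le_rfl⟩⟩
    set u' := T'.min' hTne'
    obtain ⟨huS', huu', hut'⟩ := Finset.mem_filter.1 (T'.min'_mem hTne')
    have hcons : Φ u' - Φ u = A u u' := by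
      refine hΦ u huS u' huS' huu' fun r hr hr' => ?_
      exact absurd (T'.min'_le r (by
        rw [hT', Finset.mem_filter]; exact ⟨hr, hr'.1, hr'.2.le.trans hut'⟩)) (not_le.2 hr'.2)
    have hVu' : V u' t ≤ V s t / 2 := by
      rcases hut'.eq_or_lt with h | h
      · rw [show V u' t = V t t by rw [← h], hV.diag (has.trans hst) htb]
        positivity
      · have h1 : V s t / 2 < V s u' := by
          by_contra hcon
          exact absurd (T.le_max' u' (by
            rw [hT, Finset.mem_filter]
            exact ⟨huS', hsu.trans huu'.le, h, not_lt.1 hcon⟩)) (not_le.2 huu')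
        have h2 := hV.superadd s u' t has (hsu.trans huu'.le) hut' htb
        linarith
    have hc1 : (S.filter fun r => s < r ∧ r ≤ u).card < n := by
      rw [← hn]
      refine Finset.card_lt_card ((Finset.ssubset_iff_of_subset ?_).2 ⟨t, ?_, ?_⟩)
      · intro r hr
        rw [Finset.mem_filter] at hr ⊢
        exact ⟨hr.1, hr.2.1, hr.2.2.trans hut.le⟩
      · rw [Finset.mem_filter]; exact ⟨ht, hlt, le_rfl⟩
      · rw [Finset.mem_filter]; exact fun h => absurd h.2.2 (not_le.2 hut)
    have hc2 : (S.filter fun r => u' < r ∧ r ≤ t).card < n := by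
      rw [← hn]
      refine Finset.card_lt_card ((Finset.ssubset_iff_of_subset ?_).2 ⟨u', ?_, ?_⟩)
      · intro r hr
        rw [Finset.mem_filter] at hr ⊢
        exact ⟨hr.1, (hsu.trans_lt huu').trans hr.2.1, hr.2.2⟩
      · rw [Finset.mem_filter]; exact ⟨huS', hsu.trans_lt huu', hut'⟩
      · rw [Finset.mem_filter]; exact fun h => absurd h.2.1 (lt_irrefl _)
    have e1 := ih _ hc1 s hs u huS hsu rfl
    have e2 := ih _ hc2 u' huS' t ht hut' rfl
    have e3 := hA s u t has hsu hut.le htb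
    have e4 := hA u u' t (has.trans hsu) huu'.le hut' htb
    have hhalf : (V s t / 2) ^ θ = V s t ^ θ * (1 / 2 : ℝ) ^ θ := by
      rw [← Real.mul_rpow hVst (by norm_num)]; ring_nf
    have b1 : V s u ^ θ ≤ V s t ^ θ * (1 / 2 : ℝ) ^ θ := by
      rw [← hhalf]
      exact Real.rpow_le_rpow (hV.nonneg s u has hsu (hut.le.trans htb)) hVu (by linarith)
    have b2 : V u' t ^ θ ≤ V s t ^ θ * (1 / 2 : ℝ) ^ θ := by
      rw [← hhalf]
      exact Real.rpow_le_rpow (hV.nonneg u' t (has.trans (hsu.trans huu'.le)) hut' htb) hVu'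
        (by linarith)
    have b4 : V u t ^ θ ≤ V s t ^ θ :=
      Real.rpow_le_rpow (hV.nonneg u t (has.trans hsu) hut.le htb)
        (hV.mono has hsu hut.le le_rfl htb) (by linarith)
    have hdec : Φ t - Φ s - A s t = (Φ t - Φ u' - A u' t) + (Φ u - Φ s - A s u)
        - (A s t - A s u - A u t) - (A u t - A u u' - A u' t) := by
      rw [← hcons]; abel
    calc ‖Φ t - Φ s - A s t‖
        ≤ ‖Φ t - Φ u' - A u' t‖ + ‖Φ u - Φ s - A s u‖ + ‖A s t - A s u - A u t‖
          + ‖A u t - A u u' - A u' t‖ := by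
          rw [hdec]
          exact (norm_sub_le _ _).trans (add_le_add_left ((norm_sub_le _ _).trans
            (add_le_add_left (norm_add_le _ _) _)) _)
      _ ≤ sewConst θ * C * (V s t ^ θ * (1 / 2 : ℝ) ^ θ)
          + sewConst θ * C * (V s t ^ θ * (1 / 2 : ℝ) ^ θ)
          + C * V s t ^ θ + C * V s t ^ θ := by
          gcongr
          · exact e2.trans (by gcongr)
          · exact e1.trans (by gcongr)
          · exact e4.trans (by gcongr)
      _ = (sewConst θ * (2 * (1 / 2 : ℝ) ^ θ) + 2) * C * V s t ^ θ := by ring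
      _ = sewConst θ * C * V s t ^ θ := by rw [sewConst_eq hθ]

/-- **Sewing lemma**: an almost additive two-parameter function is close to the increments of
a function. -/
theorem exists_sewing [ProperSpace F] {a b : ℝ} {V : ℝ → ℝ → ℝ} (hV : IsSuperadd a b V)
    {θ C : ℝ} (hθ : 1 < θ) (hC : 0 ≤ C) {A : ℝ → ℝ → F}
    (hA : ∀ u v w : ℝ, a ≤ u → u ≤ v → v ≤ w → w ≤ b →
      ‖A u w - A u v - A v w‖ ≤ C * V u w ^ θ) :
    ∃ I : ℝ → F, ∀ s t : ℝ, a ≤ s → s ≤ t → t ≤ b →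
      ‖I t - I s - A s t‖ ≤ sewConst θ * C * V s t ^ θ := by
  classical
  choose Φ hΦ using fun S : Finset ℝ => exists_finset_primitive A (S.filter fun r => a ≤ r ∧ r ≤ b)
  have hb : ∀ S : Finset ℝ, ∀ s ∈ S, ∀ t ∈ S, a ≤ s → s ≤ t → t ≤ b →
      ‖Φ S t - Φ S s - A s t‖ ≤ sewConst θ * C * V s t ^ θ := by
    intro S s hs t ht has hst htb
    refine finset_sewing_bound hV hθ hC hA (fun r hr => (Finset.mem_filter.1 hr).2) (hΦ S) _
      s (Finset.mem_filter.2 ⟨hs, has, hst.trans htb⟩) t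
      (Finset.mem_filter.2 ⟨ht, has.trans hst, htb⟩) hst rfl
  let U : Ultrafilter (Finset ℝ) := Ultrafilter.of Filter.atTop
  have hmem : ∀ t : ℝ, ∀ᶠ S in (U : Filter (Finset ℝ)), t ∈ S := fun t =>
    (Ultrafilter.of_le Filter.atTop) (by
      filter_upwards [Filter.eventually_ge_atTop ({t} : Finset ℝ)] with S hS
      exact hS (Finset.mem_singleton_self t))
  have hlim : ∀ t : ℝ, ∃ y : F, a ≤ t → t ≤ b →
      Filter.Tendsto (fun S => Φ S t - Φ S a) U (nhds y) := by
    intro t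
    by_cases h : a ≤ t ∧ t ≤ b
    · obtain ⟨y, -, hy⟩ := (isCompact_closedBall (0 : F)
        (‖A a t‖ + sewConst θ * C * V a t ^ θ)).ultrafilter_le_nhds
        (U.map fun S => Φ S t - Φ S a) (by
          rw [Ultrafilter.coe_map, Filter.le_principal_iff, Filter.mem_map]
          filter_upwards [hmem a, hmem t] with S hS hS'
          rw [Set.mem_preimage, mem_closedBall_zero_iff]
          have h1 := hb S a hS t hS' le_rfl h.1 h.2
          have h2 := norm_add_le (Φ S t - Φ S a - A a t) (A a t)
          rw [sub_add_cancel] at h2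
          linarith)
      exact ⟨y, fun _ _ => hy⟩
    · exact ⟨0, fun h1 h2 => absurd ⟨h1, h2⟩ h⟩
  choose I hI using hlim
  refine ⟨I, fun s t has hst htb => ?_⟩
  have h1 := ((hI t (has.trans hst) htb).sub (hI s has (hst.trans htb))).sub_const (A s t)
  refine le_of_tendsto h1.norm ?_
  filter_upwards [hmem s, hmem t] with S hS hS'
  rw [show Φ S t - Φ S a - (Φ S s - Φ S a) - A s t = Φ S t - Φ S s - A s t by abel]
  exact hb S s hS t hS' has hst htb

/-- A function whose increments are `O(U s t ^ θ)` with `θ > 1` is constant. -/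
theorem eq_of_norm_sub_le_rpow {a b : ℝ} {U : ℝ → ℝ → ℝ} (hU : IsSuperadd a b U)
    (hU' : VanishesOnDiag a b U) {θ C : ℝ} (hθ : 1 < θ) (hC : 0 ≤ C) {H : ℝ → F}
    (hH : ∀ s t : ℝ, a ≤ s → s ≤ t → t ≤ b → ‖H t - H s‖ ≤ C * U s t ^ θ)
    {s t : ℝ} (has : a ≤ s) (hst : s ≤ t) (htb : t ≤ b) : H t = H s := by
  have key : ∀ ε : ℝ, 0 < ε → ‖H t - H s‖ ≤ ε * (C * U s t) := by
    intro ε hε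
    obtain ⟨η, hη, h⟩ := VanishesOnDiag.rpow_le_mul hU hU' hθ hε
    obtain ⟨n, hn⟩ := exists_nat_gt ((t - s) / η)
    have hn0 : (0 : ℝ) < n := lt_of_le_of_lt (div_nonneg (sub_nonneg.2 hst) hη.le) hn
    let u : ℕ → ℝ := fun i => s + (t - s) / n * i
    have hstep : 0 ≤ (t - s) / n := div_nonneg (sub_nonneg.2 hst) hn0.le
    have hmono : Monotone u := fun i j hij => by
      have : (i : ℝ) ≤ j := by exact_mod_cast hij
      simp only [u]; gcongr
    have hu0 : u 0 = s := by simp [u]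
    have hun : u n = t := by simp only [u]; field_simp; ring
    have hsum : H t - H s = ∑ i ∈ Finset.range n, (H (u (i + 1)) - H (u i)) := by
      rw [Finset.sum_range_sub (fun i => H (u i)), hu0, hun]
    calc ‖H t - H s‖ ≤ ∑ i ∈ Finset.range n, ‖H (u (i + 1)) - H (u i)‖ := by
          rw [hsum]; exact norm_sum_le _ _
      _ ≤ ∑ i ∈ Finset.range n, C * (ε * U (u i) (u (i + 1))) := by
          refine Finset.sum_le_sum fun i hi => ?_
          have hi' : i + 1 ≤ n := Finset.mem_range.1 hi
          have h1 : a ≤ u i := has.trans (hu0 ▸ hmono i.zero_le)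
          have h2 : u (i + 1) ≤ b := ((hmono hi').trans hun.le).trans htb
          refine (hH _ _ h1 (hmono i.le_succ) h2).trans ?_
          have h3 := h _ _ h1 (hmono i.le_succ) h2 (by
            have : u (i + 1) - u i = (t - s) / n := by simp only [u]; push_cast; ring
            rw [this, div_lt_iff₀ hn0]
            rw [div_lt_iff₀ hη] at hn
            linarith)
          gcongr
      _ = C * ε * ∑ i ∈ Finset.range n, U (u i) (u (i + 1)) := by
          rw [Finset.mul_sum]; exact Finset.sum_congr rfl fun i _ => by ring
      _ ≤ C * ε * U s t := by
          have := hU.sum_le hmono (hu0.symm ▸ has) n (hun.le.trans htb)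
          rw [hu0, hun] at this
          gcongr
      _ = ε * (C * U s t) := by ring
  have hz : ‖H t - H s‖ ≤ 0 := by
    have hUn := mul_nonneg hC (hU.nonneg s t has hst htb)
    refine le_of_forall_pos_le_add fun ε hε => ?_
    have := key (ε / (C * U s t + 1)) (by positivity)
    refine this.trans ?_
    rw [zero_add, div_mul_eq_mul_div, div_le_iff₀ (by positivity)]
    nlinarith
  exact sub_eq_zero.1 (norm_le_zero_iff.1 hz)

end Sewing
section YoungIntegral

variable {E F : Type*} [NormedAddCommGroup E] [NormedSpace ℝ E]
  [NormedAddCommGroup F] [NormedSpace ℝ F]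

theorem TaggedPartition.sub_le_mesh {a b : ℝ} (P : TaggedPartition a b) (i : Fin P.n) :
    P.t i.succ - P.t i.castSucc ≤ P.mesh :=
  le_ciSup (f := fun i : Fin P.n => P.t i.succ - P.t i.castSucc) (Set.finite_range _).bddAbove i

/-- The partition points as a monotone sequence, eventually constant. -/
def TaggedPartition.seq {a b : ℝ} (P : TaggedPartition a b) (i : ℕ) : ℝ :=
  P.t ⟨min i P.n, by omega⟩

theorem TaggedPartition.seq_mono {a b : ℝ} (P : TaggedPartition a b) : Monotone P.seq :=
  fun i j hij => P.mono.monotone (by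
    rw [Fin.mk_le_mk]; exact min_le_min_right _ hij)

theorem TaggedPartition.seq_castSucc {a b : ℝ} (P : TaggedPartition a b) (i : Fin P.n) :
    P.seq i = P.t i.castSucc := by
  unfold TaggedPartition.seq
  congr 1
  ext
  simp [i.2.le]

theorem TaggedPartition.seq_succ {a b : ℝ} (P : TaggedPartition a b) (i : Fin P.n) :
    P.seq (i + 1) = P.t i.succ := by
  unfold TaggedPartition.seq
  congr 1
  ext
  have := i.2
  simp only [Fin.val_succ]
  omega

theorem TaggedPartition.seq_zero {a b : ℝ} (P : TaggedPartition a b) : P.seq 0 = a :=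
  (congrArg P.t (by ext; simp)).trans P.first

theorem TaggedPartition.seq_last {a b : ℝ} (P : TaggedPartition a b) : P.seq P.n = b :=
  (congrArg P.t (by ext; simp)).trans P.last

theorem TaggedPartition.sum_eq_sum_range {a b : ℝ} (P : TaggedPartition a b)
    {G : Type*} [AddCommMonoid G] (φ : ℝ → ℝ → G) :
    ∑ i : Fin P.n, φ (P.t i.castSucc) (P.t i.succ)
      = ∑ i ∈ Finset.range P.n, φ (P.seq i) (P.seq (i + 1)) := by
  rw [Finset.sum_range]
  exact Finset.sum_congr rfl fun i _ => by rw [P.seq_castSucc, P.seq_succ]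

theorem TaggedPartition.exists_mesh_lt {a b : ℝ} (hab : a ≤ b) {δ : ℝ} (hδ : 0 < δ) :
    ∃ P : TaggedPartition a b, P.mesh < δ := by
  rcases hab.eq_or_lt with rfl | hab
  · refine ⟨⟨0, fun _ => a, fun _ => a, fun i j h => ?_, rfl, rfl, fun i => i.elim0⟩, ?_⟩
    · exact absurd h (by omega)
    · unfold TaggedPartition.mesh
      simpa using hδ
  · obtain ⟨n, hn⟩ := exists_nat_gt ((b - a) / (δ / 2))
    have hn0 : (0 : ℝ) < n := lt_of_le_of_lt (by have := sub_pos.2 hab; positivity) hn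
    have hstep : 0 < (b - a) / n := div_pos (sub_pos.2 hab) hn0
    have hmono : StrictMono fun i : Fin (n + 1) => a + (b - a) / n * (i : ℝ) := by
      intro i j hij
      have : ((i : ℕ) : ℝ) < (j : ℕ) := by exact_mod_cast hij
      simp only
      gcongr
    refine ⟨⟨n, fun i => a + (b - a) / n * (i : ℝ), fun i => a + (b - a) / n * (i : ℝ), hmono,
      by simp, ?_, fun i => ⟨le_rfl, (hmono i.castSucc_lt_succ).le⟩⟩, ?_⟩
    · simp only [Fin.val_last]; field_simp; ring
    · refine lt_of_le_of_lt (Real.iSup_le (a := δ / 2) (fun i => ?_) (by positivity)) (by linarith)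
      simp only [Fin.val_succ, Fin.val_castSucc]
      push_cast
      rw [div_lt_iff₀ (by positivity)] at hn
      have : (b - a) / n ≤ δ / 2 := by rw [div_le_iff₀ hn0]; linarith
      linarith

theorem IsYoungIntegral.unique {X : ℝ → E →L[ℝ] F} {ω : ℝ → E} {a b : ℝ} (hab : a ≤ b) {v v' : F}
    (h : IsYoungIntegral X ω a b v) (h' : IsYoungIntegral X ω a b v') : v = v' := by
  refine eq_of_forall_dist_le fun ε hε => ?_
  obtain ⟨δ, hδ, H⟩ := h (ε / 2) (by positivity)
  obtain ⟨δ', hδ', H'⟩ := h' (ε / 2) (by positivity)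
  obtain ⟨P, hP⟩ := TaggedPartition.exists_mesh_lt hab (lt_min hδ hδ')
  have e1 := H P (hP.trans_le (min_le_left _ _))
  have e2 := H' P (hP.trans_le (min_le_right _ _))
  rw [← dist_eq_norm] at e1 e2
  have := dist_triangle_left v v' (RSSum X ω P)
  linarith

theorem IsYoungIntegral.youngIntegral_eq {X : ℝ → E →L[ℝ] F} {ω : ℝ → E} {a b : ℝ} (hab : a ≤ b)
    {v : F} (h : IsYoungIntegral X ω a b v) : youngIntegral X ω a b = v := by
  have hex : ∃ v, IsYoungIntegral X ω a b v := ⟨v, h⟩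
  unfold youngIntegral
  rw [dif_pos hex]
  exact IsYoungIntegral.unique hab hex.choose_spec h

theorem isYoungIntegral_of_norm_sub_le {X : ℝ → E →L[ℝ] F} {ω : ℝ → E} {a b : ℝ}
    {V : ℝ → ℝ → ℝ} (hV : IsSuperadd a b V) (hV' : VanishesOnDiag a b V) {θ C : ℝ}
    (hθ : 1 < θ) (hC : 0 ≤ C) {I : ℝ → F}
    (hI : ∀ s r t : ℝ, a ≤ s → s ≤ r → r ≤ t → t ≤ b →
      ‖X r (ω t - ω s) - (I t - I s)‖ ≤ C * V s t ^ θ) (hab : a ≤ b) :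
    IsYoungIntegral X ω a b (I b - I a) := by
  intro ε hε
  have hVab := hV.nonneg a b le_rfl hab le_rfl
  obtain ⟨η, hη, h⟩ := VanishesOnDiag.rpow_le_mul hV hV' hθ
    (show 0 < ε / (2 * (C * V a b + 1)) by positivity)
  set ε' := ε / (2 * (C * V a b + 1)) with hε'
  refine ⟨η, hη, fun P hP => ?_⟩
  have hlo : ∀ i : Fin P.n, a ≤ P.t i.castSucc := fun i =>
    P.first.symm.trans_le (P.mono.monotone (Fin.zero_le _))
  have hhi : ∀ i : Fin P.n, P.t i.succ ≤ b := fun i =>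
    (P.mono.monotone (Fin.le_last _)).trans_eq P.last
  have htel : I b - I a = ∑ i : Fin P.n, (I (P.t i.succ) - I (P.t i.castSucc)) := by
    rw [P.sum_eq_sum_range fun s t => I t - I s,
      Finset.sum_range_sub (fun i => I (P.seq i)), P.seq_zero, P.seq_last]
  have hsum : ∑ i : Fin P.n, V (P.t i.castSucc) (P.t i.succ) ≤ V a b := by
    have := hV.sum_le P.seq_mono P.seq_zero.ge P.n P.seq_last.le
    rwa [P.seq_zero, P.seq_last, ← P.sum_eq_sum_range V] at this
  unfold RSSum
  rw [htel, ← Finset.sum_sub_distrib]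
  calc _ ≤ ∑ i : Fin P.n, C * (ε' * V (P.t i.castSucc) (P.t i.succ)) := by
        refine norm_sum_le_of_le _ fun i _ => ?_
        have h1 := hI _ (P.tag i) _ (hlo i) (P.tag_mem i).1 (P.tag_mem i).2 (hhi i)
        have h2 := h _ _ (hlo i) (P.mono i.castSucc_lt_succ).le (hhi i)
          ((P.sub_le_mesh i).trans_lt hP)
        exact h1.trans (by gcongr)
    _ = C * ε' * ∑ i : Fin P.n, V (P.t i.castSucc) (P.t i.succ) := by
        rw [Finset.mul_sum]; exact Finset.sum_congr rfl fun i _ => by ring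
    _ ≤ C * ε' * V a b := by gcongr
    _ < ε := by
        rw [hε', show C * (ε / (2 * (C * V a b + 1))) * V a b
          = ε * (C * V a b) / (2 * (C * V a b + 1)) by ring, div_lt_iff₀ (by positivity)]
        have : 0 ≤ C * V a b := by positivity
        nlinarith

end YoungIntegral

section PVariation

variable {E : Type*} [NormedAddCommGroup E]

theorem zero_mem_pVarSums (p : ℝ) (x : ℝ → E) (a : ℝ) : 0 ∈ pVarSums p x a a :=
  ⟨0, fun _ => a, fun i j h => absurd h (by omega),
    rfl, rfl, by simp⟩

theorem add_mem_pVarSums {p : ℝ} {x : ℝ → E} {a s t σ : ℝ} (hst : s < t)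
    (hσ : σ ∈ pVarSums p x a s) : σ + ‖x t - x s‖ ^ p ∈ pVarSums p x a t := by
  obtain ⟨n, u, hu, h0, hl, rfl⟩ := hσ
  refine ⟨n + 1, Fin.snoc (α := fun _ => ℝ) u t, ?_, ?_, ?_, ?_⟩
  · rw [Fin.strictMono_iff_lt_succ]
    intro i
    refine Fin.lastCases ?_ (fun j => ?_) i
    · rw [Fin.succ_last, Fin.snoc_last, Fin.snoc_castSucc, hl]
      exact hst
    · rw [← Fin.castSucc_succ, Fin.snoc_castSucc, Fin.snoc_castSucc]
      exact hu j.castSucc_lt_succ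
  · rw [← Fin.castSucc_zero, Fin.snoc_castSucc, h0]
  · rw [Fin.snoc_last]
  · rw [Fin.sum_univ_castSucc, Fin.succ_last, Fin.snoc_last, Fin.snoc_castSucc, hl]
    congr 1
    refine Finset.sum_congr rfl fun i _ => ?_
    rw [← Fin.castSucc_succ, Fin.snoc_castSucc, Fin.snoc_castSucc]

theorem FinitePVar.exists_monotoneOn {p : ℝ} (hp : 0 < p) {x : ℝ → E} {a b : ℝ}
    (hx : FinitePVar p x a b) :
    ∃ v : ℝ → ℝ, MonotoneOn v (Icc a b) ∧
      ∀ s t : ℝ, a ≤ s → s ≤ t → t ≤ b → ‖x t - x s‖ ^ p ≤ v t - v s := by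
  have hne : ∀ t : ℝ, a ≤ t → (pVarSums p x a t).Nonempty := by
    intro t ht
    rcases ht.eq_or_lt with rfl | ht
    · exact ⟨0, zero_mem_pVarSums p x a⟩
    · exact ⟨_, add_mem_pVarSums ht (zero_mem_pVarSums p x a)⟩
  have hbdd : ∀ t : ℝ, t ≤ b → BddAbove (pVarSums p x a t) := by
    intro t ht
    rcases ht.eq_or_lt with rfl | ht
    · exact hx
    · obtain ⟨B, hB⟩ := hx
      refine ⟨B, fun σ hσ => ?_⟩
      have h1 := hB (add_mem_pVarSums ht hσ)
      have h2 : 0 ≤ ‖x b - x t‖ ^ p := by positivity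
      linarith
  have key : ∀ s t : ℝ, a ≤ s → s ≤ t → t ≤ b →
      ‖x t - x s‖ ^ p ≤ sSup (pVarSums p x a t) - sSup (pVarSums p x a s) := by
    intro s t has hst htb
    rcases hst.eq_or_lt with rfl | hst
    · simp [Real.zero_rpow hp.ne']
    · rw [le_sub_iff_add_le, add_comm, ← le_sub_iff_add_le]
      refine csSup_le (hne s has) fun σ hσ => ?_
      rw [le_sub_iff_add_le]
      exact le_csSup (hbdd t htb) (add_mem_pVarSums hst hσ)
  refine ⟨fun t => sSup (pVarSums p x a t), fun s hs t ht hst => ?_, key⟩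
  have h1 := key s t hs.1 hst ht.2
  have h2 : 0 ≤ ‖x t - x s‖ ^ p := by positivity
  simp only
  linarith

/-- A continuous path of finite `p`-variation is controlled, for every `γ < 1 / p`, by the
power `γ` of a superadditive function vanishing on the diagonal. -/
theorem FinitePVar.exists_vanishing_control {p γ : ℝ} (hp : 0 < p) (hγ : 0 < γ) (hγp : γ < 1 / p)
    {x : ℝ → E} {a b : ℝ} (hab : a ≤ b) (hc : ContinuousOn x (Icc a b))
    (hx : FinitePVar p x a b) :
    ∃ W : ℝ → ℝ → ℝ, IsSuperadd a b W ∧ VanishesOnDiag a b W ∧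
      ∀ s t : ℝ, a ≤ s → s ≤ t → t ≤ b → ‖x t - x s‖ ≤ W s t ^ γ := by
  obtain ⟨v, hv, hxv⟩ := hx.exists_monotoneOn hp
  have hbd : Bornology.IsBounded (x '' Icc a b) := (isCompact_Icc.image_of_continuousOn hc).isBounded
  have hpγ : 0 < 1 / γ - p := by
    rw [sub_pos, lt_one_div hp hγ]; exact hγp
  have hv' := IsSuperadd.of_monotoneOn hv
  have hsub : ∀ s t, a ≤ s → t ≤ b → x '' Icc s t ⊆ x '' Icc a b := fun s t hs ht =>
    image_mono (Icc_subset_Icc hs ht)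
  refine ⟨fun s t => Metric.diam (x '' Icc s t) ^ (1 / γ - p) * (v t - v s), ⟨?_, ?_⟩, ?_, ?_⟩
  · intro s t hs hst ht
    exact mul_nonneg (Real.rpow_nonneg Metric.diam_nonneg _) (hv'.nonneg s t hs hst ht)
  · intro s t u hs hst htu hu
    have d1 : Metric.diam (x '' Icc s t) ≤ Metric.diam (x '' Icc s u) :=
      Metric.diam_mono (image_mono (Icc_subset_Icc le_rfl htu)) (hbd.subset (hsub s u hs hu))
    have d2 : Metric.diam (x '' Icc t u) ≤ Metric.diam (x '' Icc s u) :=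
      Metric.diam_mono (image_mono (Icc_subset_Icc hst le_rfl)) (hbd.subset (hsub s u hs hu))
    have n1 := hv'.nonneg s t hs hst (htu.trans hu)
    have n2 := hv'.nonneg t u (hs.trans hst) htu hu
    have n3 : 0 ≤ Metric.diam (x '' Icc s t) := Metric.diam_nonneg
    have n4 : 0 ≤ Metric.diam (x '' Icc t u) := Metric.diam_nonneg
    calc _ ≤ Metric.diam (x '' Icc s u) ^ (1 / γ - p) * (v t - v s)
          + Metric.diam (x '' Icc s u) ^ (1 / γ - p) * (v u - v t) := by gcongr
      _ = _ := by ring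
  · have hvab := hv'.nonneg a b le_rfl hab le_rfl
    intro ε hε
    set e := 1 / γ - p
    set ρ := (ε / (v b - v a + 1)) ^ (1 / e) with hρ
    have hρ0 : 0 < ρ := by positivity
    have hu := isCompact_Icc.uniformContinuousOn_of_continuous hc
    obtain ⟨η, hη, h⟩ := Metric.uniformContinuousOn_iff.1 hu ρ hρ0
    refine ⟨η, hη, fun s t hs hst ht hd => ?_⟩
    have h1 : Metric.diam (x '' Icc s t) ≤ ρ := by
      refine Metric.diam_le_of_forall_dist_le hρ0.le ?_
      rintro _ ⟨r, hr, rfl⟩ _ ⟨r', hr', rfl⟩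
      refine (h r ⟨hs.trans hr.1, hr.2.trans ht⟩ r' ⟨hs.trans hr'.1, hr'.2.trans ht⟩ ?_).le
      rw [Real.dist_eq, abs_lt]
      constructor <;> linarith [hr.1, hr.2, hr'.1, hr'.2]
    have h2 : Metric.diam (x '' Icc s t) ^ e ≤ ε / (v b - v a + 1) := by
      calc _ ≤ ρ ^ e := Real.rpow_le_rpow Metric.diam_nonneg h1 hpγ.le
        _ = _ := by
          rw [hρ, ← Real.rpow_mul (by positivity), one_div_mul_cancel hpγ.ne', Real.rpow_one]
    have h3 := hv'.mono le_rfl hs hst ht le_rfl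
    have h4 := hv'.nonneg s t hs hst ht
    calc _ ≤ ε / (v b - v a + 1) * (v b - v a) := mul_le_mul h2 h3 h4 (by positivity)
      _ ≤ ε := by
        rw [div_mul_eq_mul_div, div_le_iff₀ (by positivity)]; nlinarith
  · intro s t hs hst ht
    have h1 : ‖x t - x s‖ ≤ Metric.diam (x '' Icc s t) := by
      rw [← dist_eq_norm]
      exact Metric.dist_le_diam_of_mem (hbd.subset (hsub s t hs ht))
        (mem_image_of_mem x (right_mem_Icc.2 hst)) (mem_image_of_mem x (left_mem_Icc.2 hst))
    have h2 := hxv s t hs hst ht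
    rcases (norm_nonneg (x t - x s)).eq_or_lt with h0 | h0
    · rw [← h0]
      exact Real.rpow_nonneg (mul_nonneg (Real.rpow_nonneg Metric.diam_nonneg _)
        (hv'.nonneg s t hs hst ht)) _
    · calc ‖x t - x s‖ = (‖x t - x s‖ ^ (1 / γ - p) * ‖x t - x s‖ ^ p) ^ γ := by
            rw [← Real.rpow_add h0, ← Real.rpow_mul h0.le, sub_add_cancel,
              one_div_mul_cancel hγ.ne', Real.rpow_one]
        _ ≤ _ := by
            have := hv'.nonneg s t hs hst ht
            simp only at this ⊢
            gcongr

end PVariation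
section YoungEstimates

variable {E F : Type*} [NormedAddCommGroup E] [NormedSpace ℝ E]
  [NormedAddCommGroup F] [NormedSpace ℝ F]

/-- If `w ≤ T`, powers of `w` with exponent at least `κ` are dominated by `w ^ κ`. -/
theorem Real.rpow_le_rpow_sub_mul_rpow {w T κ e : ℝ} (hw : 0 ≤ w) (hwT : w ≤ T) (hκ : 0 < κ)
    (he : κ ≤ e) : w ^ e ≤ T ^ (e - κ) * w ^ κ := by
  rcases hw.eq_or_lt with rfl | hw
  · rw [Real.zero_rpow (hκ.trans_le he).ne', Real.zero_rpow hκ.ne', mul_zero]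
  · calc w ^ e = w ^ (e - κ) * w ^ κ := by rw [← Real.rpow_add hw, sub_add_cancel]
      _ ≤ _ := by
        have : 0 ≤ e - κ := sub_nonneg.2 he
        gcongr

theorem norm_germ_le {a b : ℝ} {D : ℝ → E →L[ℝ] F} {ω : ℝ → E} {W₁ W₂ : ℝ → ℝ → ℝ}
    (hW₁ : IsSuperadd a b W₁) (hW₂ : IsSuperadd a b W₂) {κ γ c : ℝ} (hκ : 0 < κ) (hγ : 0 < γ)
    (hc : 0 ≤ c)
    (hD : ∀ s t : ℝ, a ≤ s → s ≤ t → t ≤ b → ‖D t - D s‖ ≤ c * W₁ s t ^ κ)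
    (hω : ∀ s t : ℝ, a ≤ s → s ≤ t → t ≤ b → ‖ω t - ω s‖ ≤ W₂ s t ^ γ)
    {u v w : ℝ} (hu : a ≤ u) (huv : u ≤ v) (hvw : v ≤ w) (hw : w ≤ b) :
    ‖D u (ω w - ω u) - D u (ω v - ω u) - D v (ω w - ω v)‖ ≤ c * (W₁ u w ^ κ * W₂ u w ^ γ) := by
  have h1 : D u (ω w - ω u) - D u (ω v - ω u) - D v (ω w - ω v) = -((D v - D u) (ω w - ω v)) := by
    rw [← map_sub, sub_sub_sub_cancel_right, sub_apply]
    abel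
  rw [h1, norm_neg]
  have n1 := hW₁.nonneg u v hu huv (hvw.trans hw)
  have n2 := hW₂.nonneg v w (hu.trans huv) hvw hw
  have m1 := hW₁.mono hu le_rfl huv hvw hw
  have m2 := hW₂.mono hu huv hvw le_rfl hw
  calc _ ≤ ‖D v - D u‖ * ‖ω w - ω v‖ := ContinuousLinearMap.le_opNorm _ _
    _ ≤ c * W₁ u v ^ κ * W₂ v w ^ γ := mul_le_mul (hD u v hu huv (hvw.trans hw))
        (hω v w (hu.trans huv) hvw hw) (norm_nonneg _) (by positivity)
    _ ≤ c * W₁ u w ^ κ * W₂ u w ^ γ := by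
        have n3 := n1.trans m1
        gcongr
    _ = _ := by ring

/-- Young–Loève estimate for the increments of the Young integral. -/
theorem youngIntegral_estimate [ProperSpace F] {a b : ℝ} {D : ℝ → E →L[ℝ] F} {ω : ℝ → E}
    {W₁ W₂ : ℝ → ℝ → ℝ} (hab : a ≤ b)
    (hW₁ : IsSuperadd a b W₁) (hW₂ : IsSuperadd a b W₂) (hW₂' : VanishesOnDiag a b W₂)
    {κ γ c : ℝ} (hκ : 0 < κ) (hγ : 0 < γ) (hθ : 1 < κ + γ) (hc : 0 ≤ c)
    (hD : ∀ s t : ℝ, a ≤ s → s ≤ t → t ≤ b → ‖D t - D s‖ ≤ c * W₁ s t ^ κ)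
    (hω : ∀ s t : ℝ, a ≤ s → s ≤ t → t ≤ b → ‖ω t - ω s‖ ≤ W₂ s t ^ γ) :
    ∃ V : ℝ → ℝ → ℝ, IsSuperadd a b V ∧ VanishesOnDiag a b V ∧
      (∀ s t : ℝ, a ≤ s → s ≤ t → t ≤ b → V s t ^ (κ + γ) = W₁ s t ^ κ * W₂ s t ^ γ) ∧
      ∀ s t : ℝ, a ≤ s → s ≤ t → t ≤ b →
        ‖youngIntegral D ω a t - youngIntegral D ω a s - D s (ω t - ω s)‖
          ≤ sewConst (κ + γ) * c * V s t ^ (κ + γ) := by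
  have hθ0 : 0 < κ + γ := by linarith
  have hV := hW₁.geom_mean hW₂ (div_pos hκ hθ0) (div_pos hγ hθ0) (by field_simp)
  set V : ℝ → ℝ → ℝ := fun s t => W₁ s t ^ (κ / (κ + γ)) * W₂ s t ^ (γ / (κ + γ)) with hVdef
  have hVpow : ∀ s t : ℝ, a ≤ s → s ≤ t → t ≤ b →
      V s t ^ (κ + γ) = W₁ s t ^ κ * W₂ s t ^ γ := by
    intro s t hs hst ht
    have n1 := hW₁.nonneg s t hs hst ht
    have n2 := hW₂.nonneg s t hs hst ht
    rw [hVdef]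
    simp only
    rw [Real.mul_rpow (by positivity) (by positivity), ← Real.rpow_mul n1, ← Real.rpow_mul n2,
      div_mul_cancel₀ _ hθ0.ne', div_mul_cancel₀ _ hθ0.ne']
  have hV' : VanishesOnDiag a b V := by
    intro ε hε
    obtain ⟨η, hη, h⟩ := VanishesOnDiag.const_mul_rpow hW₂ hW₂'
      (c := W₁ a b ^ (κ / (κ + γ))) (Real.rpow_nonneg (hW₁.nonneg a b le_rfl hab le_rfl) _)
      (div_pos hγ hθ0) ε hε
    refine ⟨η, hη, fun s t hs hst ht hd => le_trans ?_ (h s t hs hst ht hd)⟩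
    have n1 := hW₁.nonneg s t hs hst ht
    have n2 := hW₂.nonneg s t hs hst ht
    have m1 := hW₁.mono le_rfl hs hst ht le_rfl
    simp only [hVdef]
    gcongr
  obtain ⟨I, hI⟩ := exists_sewing hV hθ hc (A := fun s t => D s (ω t - ω s))
    (fun u v w hu huv hvw hw => by
      rw [hVpow u w hu (huv.trans hvw) hw]
      exact norm_germ_le hW₁ hW₂ hκ hγ hc hD hω hu huv hvw hw)
  have hY : ∀ t : ℝ, a ≤ t → t ≤ b → youngIntegral D ω a t = I t - I a := by
    intro t hat htb
    refine IsYoungIntegral.youngIntegral_eq hat ?_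
    have hK := sewConst_pos hθ
    refine isYoungIntegral_of_norm_sub_le (hV.restrict le_rfl htb) (hV'.restrict le_rfl htb) hθ
      (C := c + sewConst (κ + γ) * c) (by positivity) (fun s r u hs hsr hru hu => ?_) hat
    have hub := hu.trans htb
    have h1 := hI s u hs (hsr.trans hru) hub
    have n1 := hW₁.nonneg s r hs hsr (hru.trans hub)
    have n2 := hW₂.nonneg s u hs (hsr.trans hru) hub
    have m1 := hW₁.mono hs le_rfl hsr hru hub
    have h2 : ‖(D r - D s) (ω u - ω s)‖ ≤ c * V s u ^ (κ + γ) := by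
      rw [hVpow s u hs (hsr.trans hru) hub]
      calc _ ≤ ‖D r - D s‖ * ‖ω u - ω s‖ := ContinuousLinearMap.le_opNorm _ _
        _ ≤ c * W₁ s r ^ κ * W₂ s u ^ γ := mul_le_mul (hD s r hs hsr (hru.trans hub))
            (hω s u hs (hsr.trans hru) hub) (norm_nonneg _) (by positivity)
        _ ≤ c * W₁ s u ^ κ * W₂ s u ^ γ := by gcongr
        _ = _ := by ring
    have h3 : D r (ω u - ω s) - (I u - I s)
        = (D r - D s) (ω u - ω s) - (I u - I s - D s (ω u - ω s)) := by
      rw [sub_apply]; abel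
    rw [h3]
    refine (norm_sub_le _ _).trans ?_
    linarith
  refine ⟨V, hV, hV', hVpow, fun s t hs hst ht => ?_⟩
  rw [hY t (hs.trans hst) ht, hY s hs (hst.trans ht), sub_sub_sub_cancel_right]
  exact hI s t hs hst ht

/-- The local expansion of an integral function determines its remainder bound. -/
theorem norm_integral_germ_le [ProperSpace F] {a b : ℝ} {D : ℝ → E →L[ℝ] F} {ω : ℝ → E}
    {I : ℝ → F} {V W : ℝ → ℝ → ℝ} (hV : IsSuperadd a b V) (hV' : VanishesOnDiag a b V)
    (hW : IsSuperadd a b W) (hW' : VanishesOnDiag a b W)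
    {κ γ c C : ℝ} (hκ : 0 < κ) (hγ : 0 < γ) (hθ : 1 < κ + γ) (hc : 0 ≤ c) (hC : 0 ≤ C)
    (hI : ∀ s t : ℝ, a ≤ s → s ≤ t → t ≤ b →
      ‖I t - I s - D s (ω t - ω s)‖ ≤ C * V s t ^ (κ + γ))
    (hD : ∀ s t : ℝ, a ≤ s → s ≤ t → t ≤ b → ‖D t - D s‖ ≤ c * W s t ^ κ)
    (hω : ∀ s t : ℝ, a ≤ s → s ≤ t → t ≤ b → ‖ω t - ω s‖ ≤ W s t ^ γ)
    {s t : ℝ} (hs : a ≤ s) (hst : s ≤ t) (ht : t ≤ b) :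
    ‖I t - I s - D s (ω t - ω s)‖ ≤ sewConst (κ + γ) * c * W s t ^ (κ + γ) := by
  have hK := sewConst_pos hθ
  obtain ⟨J, hJ⟩ := exists_sewing hW hθ hc (A := fun s t => D s (ω t - ω s))
    (fun u v w hu huv hvw hw => by
      rw [Real.rpow_add_of_nonneg (hW.nonneg u w hu (huv.trans hvw) hw) hκ.le hγ.le]
      exact norm_germ_le hW hW hκ hγ hc hD hω hu huv hvw hw)
  have hIJ : (I - J) t = (I - J) s := by
    refine eq_of_norm_sub_le_rpow (hV.add hW) (hV'.add hW') hθ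
      (C := C + sewConst (κ + γ) * c) (by positivity) (fun s t hs hst ht => ?_) hs hst ht
    have n1 := hV.nonneg s t hs hst ht
    have n2 := hW.nonneg s t hs hst ht
    have h1 := hI s t hs hst ht
    have h2 := hJ s t hs hst ht
    have h3 : (I - J) t - (I - J) s
        = (I t - I s - D s (ω t - ω s)) - (J t - J s - D s (ω t - ω s)) := by
      simp only [Pi.sub_apply]; abel
    have h4 : V s t ^ (κ + γ) ≤ (V s t + W s t) ^ (κ + γ) :=
      Real.rpow_le_rpow n1 (by linarith) (by linarith)
    have h5 : W s t ^ (κ + γ) ≤ (V s t + W s t) ^ (κ + γ) :=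
      Real.rpow_le_rpow n2 (by linarith) (by linarith)
    rw [h3]
    calc _ ≤ C * V s t ^ (κ + γ) + sewConst (κ + γ) * c * W s t ^ (κ + γ) :=
          (norm_sub_le _ _).trans (add_le_add h1 h2)
      _ ≤ C * (V s t + W s t) ^ (κ + γ)
          + sewConst (κ + γ) * c * (V s t + W s t) ^ (κ + γ) := by gcongr
      _ = _ := by ring
  simp only [Pi.sub_apply] at hIJ
  have : I t - I s = J t - J s := by
    rw [sub_eq_sub_iff_sub_eq_sub]; exact hIJ
  rw [this]
  exact hJ s t hs hst ht

/-- A priori estimate on a short interval for paths driven by a Young integral whose integrand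
depends at most affinely on the path. -/
theorem affine_young_estimate [ProperSpace F] {σ τ : ℝ} {D : ℝ → E →L[ℝ] F} {ω : ℝ → E}
    {z I : ℝ → F} {V W : ℝ → ℝ → ℝ} (hV : IsSuperadd σ τ V) (hV' : VanishesOnDiag σ τ V)
    (hW : IsSuperadd σ τ W) (hW' : VanishesOnDiag σ τ W)
    {κ γ c C e ε N₀ : ℝ} (hκ : 0 < κ) (hκγ : κ ≤ γ) (hγ : γ ≤ 1) (hθ : 1 < κ + γ) (hc : 0 ≤ c)
    (hC : 0 ≤ C) (he : 0 ≤ e) (hε : 0 < ε) (hε1 : ε ≤ 1) (hWε : W σ τ ≤ ε)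
    (hεc : 2 * (2 + sewConst (κ + γ)) * c * ε ^ κ ≤ 1 / 2)
    (hI : ∀ s t : ℝ, σ ≤ s → s ≤ t → t ≤ τ →
      ‖I t - I s - D s (ω t - ω s)‖ ≤ C * V s t ^ (κ + γ))
    (hω : ∀ s t : ℝ, σ ≤ s → s ≤ t → t ≤ τ → ‖ω t - ω s‖ ≤ W s t ^ γ)
    (hN₀ : 0 ≤ N₀)
    (hz₀ : ∀ s t : ℝ, σ ≤ s → s ≤ t → t ≤ τ → ‖z t - z s‖ ≤ N₀ * W s t ^ γ)
    (hz : ∀ M : ℝ, (∀ r : ℝ, σ ≤ r → r ≤ τ → ‖z r‖ ≤ M) →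
      ∀ s t : ℝ, σ ≤ s → s ≤ t → t ≤ τ → ‖z t - z s - (I t - I s)‖ ≤ c * (e + M) * W s t)
    (hD : ∀ M : ℝ, (∀ r : ℝ, σ ≤ r → r ≤ τ → ‖z r‖ ≤ M) →
      ∀ r : ℝ, σ ≤ r → r ≤ τ → ‖D r‖ ≤ c * (e + M))
    (hDD : ∀ M N : ℝ, 0 ≤ N → (∀ r : ℝ, σ ≤ r → r ≤ τ → ‖z r‖ ≤ M) →
      (∀ s t : ℝ, σ ≤ s → s ≤ t → t ≤ τ → ‖z t - z s‖ ≤ N * W s t ^ γ) →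
      ∀ s t : ℝ, σ ≤ s → s ≤ t → t ≤ τ → ‖D t - D s‖ ≤ c * (e + M + N) * W s t ^ κ)
    {r s t : ℝ} (hr : σ ≤ r) (hr' : r ≤ τ) (hs : σ ≤ s) (hst : s ≤ t) (ht : t ≤ τ) :
    ‖z t - z s‖ ≤ 2 * (2 + sewConst (κ + γ)) * c * (e + ‖z r‖) * W s t ^ γ ∧
      ‖z t - z s‖ ≤ 1 / 2 * (e + ‖z r‖) := by
  have hγ0 : 0 < γ := hκ.trans_le hκγ
  have hK := sewConst_pos hθ
  set K := sewConst (κ + γ) with hKdef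
  set B := (2 + K) * c * (e + ‖z r‖) with hB
  have hB0 : 0 ≤ B := by positivity
  have hWle : ∀ s t : ℝ, σ ≤ s → s ≤ t → t ≤ τ → W s t ≤ ε := fun s t hs hst ht =>
    (hW.mono le_rfl hs hst ht le_rfl).trans hWε
  have hεpow : ε ^ γ ≤ ε ^ κ := Real.rpow_le_rpow_of_exponent_ge hε hε1 hκγ
  have hWpow : ∀ s t : ℝ, σ ≤ s → s ≤ t → t ≤ τ → W s t ^ γ ≤ ε ^ κ := fun s t hs hst ht =>
    (Real.rpow_le_rpow (hW.nonneg s t hs hst ht) (hWle s t hs hst ht) hγ0.le).trans hεpow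
  have hstep : ∀ N : ℝ, 0 ≤ N →
      (∀ s t : ℝ, σ ≤ s → s ≤ t → t ≤ τ → ‖z t - z s‖ ≤ N * W s t ^ γ) →
      ∀ s t : ℝ, σ ≤ s → s ≤ t → t ≤ τ → ‖z t - z s‖ ≤ (B + N / 2) * W s t ^ γ := by
    intro N hN hzN s t hs hst ht
    set M := ‖z r‖ + N * ε ^ κ with hM
    have hM0 : 0 ≤ M := by positivity
    have hbd : ∀ u : ℝ, σ ≤ u → u ≤ τ → ‖z u‖ ≤ M := by
      intro u hu hu'
      have h1 : ‖z u - z r‖ ≤ N * ε ^ κ := by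
        rcases le_total r u with h | h
        · exact (hzN r u hr h hu').trans (by
            have := hWpow r u hr h hu'; gcongr)
        · rw [norm_sub_rev]
          exact (hzN u r hu h hr').trans (by
            have := hWpow u r hu h hr'; gcongr)
      have h2 := norm_add_le (z r) (z u - z r)
      rw [add_sub_cancel] at h2
      linarith
    have nW := hW.nonneg s t hs hst ht
    have hW1 := hWle s t hs hst ht
    have e1 := hz M hbd s t hs hst ht
    have e2 : ‖D s (ω t - ω s)‖ ≤ c * (e + M) * W s t ^ γ :=
      (ContinuousLinearMap.le_opNorm _ _).trans
        (mul_le_mul (hD M hbd s hs (hst.trans ht)) (hω s t hs hst ht) (norm_nonneg _)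
          (by positivity))
    have e3 := norm_integral_germ_le hV hV' hW hW' hκ hγ0 hθ
      (show 0 ≤ c * (e + M + N) by positivity) hC hI (hDD M N hN hbd hzN) hω hs hst ht
    rw [← hKdef] at e3
    have e4 : W s t ≤ W s t ^ γ := by
      simpa using Real.rpow_le_rpow_of_exponent_ge' nW (hW1.trans hε1) hγ0.le hγ
    have e5 : W s t ^ (κ + γ) ≤ ε ^ κ * W s t ^ γ := by
      rw [Real.rpow_add_of_nonneg nW hκ.le hγ0.le]
      gcongr
    have hεκ : ε ^ κ ≤ 1 := Real.rpow_le_one hε.le hε1 hκ.le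
    have hdec : z t - z s = (z t - z s - (I t - I s)) + (I t - I s - D s (ω t - ω s))
        + D s (ω t - ω s) := by abel
    have nWγ : 0 ≤ W s t ^ γ := Real.rpow_nonneg nW _
    have nεκ : 0 ≤ ε ^ κ := Real.rpow_nonneg hε.le _
    calc ‖z t - z s‖ ≤ c * (e + M) * W s t + K * (c * (e + M + N)) * W s t ^ (κ + γ)
          + c * (e + M) * W s t ^ γ := by
          rw [hdec]
          exact (norm_add_le _ _).trans (add_le_add ((norm_add_le _ _).trans
            (add_le_add e1 e3)) e2)
      _ ≤ c * (e + M) * W s t ^ γ + K * (c * (e + M + N)) * (ε ^ κ * W s t ^ γ)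
          + c * (e + M) * W s t ^ γ := by gcongr
      _ = (2 * c * (e + M) + K * c * (e + M) * ε ^ κ + K * c * N * ε ^ κ) * W s t ^ γ := by ring
      _ ≤ (2 * c * (e + M) + K * c * (e + M) * 1 + (2 + K) * c * N * ε ^ κ) * W s t ^ γ := by
          gcongr; linarith
      _ = (B + 2 * (2 + K) * c * ε ^ κ * N) * W s t ^ γ := by rw [hB, hM]; ring
      _ ≤ (B + 1 / 2 * N) * W s t ^ γ := by gcongr
      _ = (B + N / 2) * W s t ^ γ := by ring
  have hiter : ∀ k : ℕ, ∀ s t : ℝ, σ ≤ s → s ≤ t → t ≤ τ →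
      ‖z t - z s‖ ≤ (2 * B + N₀ * (1 / 2 : ℝ) ^ k) * W s t ^ γ := by
    intro k
    induction k with
    | zero =>
      intro s t hs hst ht
      refine (hz₀ s t hs hst ht).trans ?_
      have := Real.rpow_nonneg (hW.nonneg s t hs hst ht) γ
      gcongr
      linarith
    | succ k ih =>
      intro s t hs hst ht
      refine (hstep _ (by positivity) ih s t hs hst ht).trans_eq ?_
      rw [pow_succ]; ring
  have hfin : ‖z t - z s‖ ≤ 2 * B * W s t ^ γ := by
    have h1 : Filter.Tendsto (fun k : ℕ => (2 * B + N₀ * (1 / 2 : ℝ) ^ k) * W s t ^ γ)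
        Filter.atTop (nhds ((2 * B + N₀ * 0) * W s t ^ γ)) :=
      (((tendsto_pow_atTop_nhds_zero_of_lt_one (by norm_num) (by norm_num)).const_mul
        N₀).const_add (2 * B)).mul_const _
    rw [mul_zero, add_zero] at h1
    exact ge_of_tendsto' h1 fun k => hiter k s t hs hst ht
  refine ⟨hfin.trans_eq (by rw [hB]; ring), hfin.trans ?_⟩
  calc 2 * B * W s t ^ γ ≤ 2 * B * ε ^ κ := by
        have := hWpow s t hs hst ht; gcongr
    _ = 2 * (2 + K) * c * ε ^ κ * (e + ‖z r‖) := by rw [hB]; ring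
    _ ≤ 1 / 2 * (e + ‖z r‖) := by gcongr

end YoungEstimates

/-- Second order increment bound for two maps with close, bounded and locally Hölder
derivatives. -/
theorem norm_four_point_le {F G : Type*} [NormedAddCommGroup F] [NormedSpace ℝ F]
    [NormedAddCommGroup G] [NormedSpace ℝ G] {φ ψ : F → G} {Dφ Dψ : F → F →L[ℝ] G}
    (hφ : ∀ x, HasFDerivAt φ (Dφ x) x) (hψ : ∀ x, HasFDerivAt ψ (Dψ x) x)
    {H L M R ρ δ : ℝ} (hδ : 0 ≤ δ) (hM : 0 ≤ M) (hH : ∀ x, ‖Dφ x - Dψ x‖ ≤ H)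
    (hL : ∀ x, ‖Dψ x‖ ≤ L)
    (hD : ∀ x y, ‖x‖ ≤ R → ‖y‖ ≤ R → ‖Dψ x - Dψ y‖ ≤ M * ‖x - y‖ ^ δ)
    {x y x' y' : F} (hx : ‖x‖ ≤ R) (hy : ‖y‖ ≤ R) (hx' : ‖x'‖ ≤ R) (hy' : ‖y'‖ ≤ R)
    (hxx : ‖x' - x‖ ≤ ρ) (hyy : ‖y' - y‖ ≤ ρ) :
    ‖φ x' - φ y' - (ψ x - ψ y)‖
      ≤ H * ‖x' - y'‖ + L * ‖x' - y' - (x - y)‖ + M * ρ ^ δ * ‖x - y‖ := by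
  have h1 : ‖(φ - ψ) x' - (φ - ψ) y'‖ ≤ H * ‖x' - y'‖ :=
    Convex.norm_image_sub_le_of_norm_hasFDerivWithin_le (s := Set.univ)
      (fun z _ => ((hφ z).sub (hψ z)).hasFDerivWithinAt) (fun z _ => hH z) convex_univ
      (Set.mem_univ _) (Set.mem_univ _)
  set z := x - y with hz
  set z' := x' - y' with hz'
  have hball : ∀ u w : F, ‖u‖ ≤ R → ‖w‖ ≤ R → ∀ r ∈ Set.Ico (0 : ℝ) 1,
      ‖u + r • (w - u)‖ ≤ R := by
    intro u w hu hw r hr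
    have h := (convex_closedBall (0 : F) R).add_smul_sub_mem
      (mem_closedBall_zero_iff.2 hu) (mem_closedBall_zero_iff.2 hw) ⟨hr.1, hr.2.le⟩
    exact mem_closedBall_zero_iff.1 h
  have hu : ∀ r : ℝ, HasDerivAt (fun r : ℝ => ψ (y' + r • z') - ψ (y + r • z))
      (Dψ (y' + r • z') z' - Dψ (y + r • z) z) r := by
    intro r
    have e : ∀ u w : F, HasDerivAt (fun r : ℝ => u + r • w) w r := fun u w => by
      simpa using ((hasDerivAt_id r).smul_const w).const_add u
    exact ((hψ _).comp_hasDerivAt r (e y' z')).sub ((hψ _).comp_hasDerivAt r (e y z))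
  have h2 := norm_image_sub_le_of_norm_deriv_le_segment_01'
    (fun r _ => (hu r).hasDerivWithinAt) (C := L * ‖z' - z‖ + M * ρ ^ δ * ‖z‖) (fun r hr => by
      have b1 := hball y' x' hy' hx' r hr
      have b2 := hball y x hy hx r hr
      rw [← hz'] at b1
      rw [← hz] at b2
      have b3 : ‖y' + r • z' - (y + r • z)‖ ≤ ρ := by
        have e : y' + r • z' - (y + r • z) = (y' - y) + r • ((x' - x) - (y' - y)) := by
          rw [hz, hz']; module
        have h := (convex_closedBall (0 : F) ρ).add_smul_sub_mem
          (mem_closedBall_zero_iff.2 hyy) (mem_closedBall_zero_iff.2 hxx) ⟨hr.1, hr.2.le⟩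
        rw [e]
        exact mem_closedBall_zero_iff.1 h
      have e : Dψ (y' + r • z') z' - Dψ (y + r • z) z
          = Dψ (y' + r • z') (z' - z) + (Dψ (y' + r • z') - Dψ (y + r • z)) z := by
        rw [map_sub (Dψ (y' + r • z')) z' z, sub_apply]; abel
      rw [e]
      refine (norm_add_le _ _).trans (add_le_add ?_ ?_)
      · exact (ContinuousLinearMap.le_opNorm _ _).trans
          (mul_le_mul_of_nonneg_right (hL _) (norm_nonneg _))
      · refine (ContinuousLinearMap.le_opNorm _ _).trans ?_
        refine mul_le_mul_of_nonneg_right ((hD _ _ b1 b2).trans ?_) (norm_nonneg _)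
        gcongr)
  have e : φ x' - φ y' - (ψ x - ψ y) = ((φ - ψ) x' - (φ - ψ) y')
      + (ψ (y' + (1 : ℝ) • z') - ψ (y + (1 : ℝ) • z)
        - (ψ (y' + (0 : ℝ) • z') - ψ (y + (0 : ℝ) • z))) := by
    simp only [one_smul, zero_smul, add_zero, hz, hz', add_sub_cancel, Pi.sub_apply]
    abel
  rw [e, add_assoc]
  exact (norm_add_le _ _).trans (add_le_add h1 h2)

/-- The coefficients of a Young differential equation on `[a,b]`, together with a
superadditive function `W` controlling time, drift and driver. -/
structure IsYoungSystem {E F : Type*} [NormedAddCommGroup E] [NormedSpace ℝ E]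
    [NormedAddCommGroup F] [NormedSpace ℝ F] (a b : ℝ) (f : ℝ → F → F) (g : ℝ → F → E →L[ℝ] F)
    (Dg : ℝ → F → F →L[ℝ] E →L[ℝ] F) (ω : ℝ → E) (W : ℝ → ℝ → ℝ) (κ γ δ q : ℝ) : Prop where
  le : a ≤ b
  superadd : IsSuperadd a b W
  vanish : VanishesOnDiag a b W
  q_pos : 0 < q
  δ_pos : 0 < δ
  κ_pos : 0 < κ
  κ_le_γ : κ ≤ γ
  κ_le_mul : κ ≤ γ * δ
  κ_le_inv : κ ≤ 1 / q
  γ_le_one : γ ≤ 1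
  one_lt : 1 < κ + γ
  driver : ∀ s t : ℝ, a ≤ s → s ≤ t → t ≤ b → ‖ω t - ω s‖ ≤ W s t ^ γ
  length : ∀ s t : ℝ, a ≤ s → s ≤ t → t ≤ b → t - s ≤ W s t
  f_cont : Continuous (fun pr : ℝ × F => f pr.1 pr.2)
  g_cont : Continuous (fun pr : ℝ × F => g pr.1 pr.2)
  f_growth : ∃ A : ℝ, 0 ≤ A ∧ ∃ B : ℝ → ℝ, IntervalIntegrable B MeasureTheory.volume a b ∧
    (∀ s t : ℝ, a ≤ s → s ≤ t → t ≤ b → ∫ r in s..t, B r ≤ W s t) ∧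
    ∀ t x, ‖f t x‖ ≤ A * ‖x‖ + B t
  f_lip : ∀ N : ℝ, 0 ≤ N → ∃ L : ℝ, 0 ≤ L ∧
    ∀ t x y, ‖x‖ ≤ N → ‖y‖ ≤ N → ‖f t x - f t y‖ ≤ L * ‖x - y‖
  g_deriv : ∀ t x, HasFDerivAt (g t) (Dg t x) x
  g_lip : ∃ L : ℝ, 0 ≤ L ∧ ∀ t x y, ‖g t x - g t y‖ ≤ L * ‖x - y‖
  g_time : ∃ H : ℝ, 0 ≤ H ∧ ∀ s t : ℝ, a ≤ s → s ≤ t → t ≤ b → ∀ x,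
    ‖g t x - g s x‖ ≤ H * W s t ^ κ ∧ ‖Dg t x - Dg s x‖ ≤ H * W s t ^ κ
  Dg_holder : ∀ N : ℝ, 0 ≤ N → ∃ M : ℝ, 0 ≤ M ∧
    ∀ t x y, ‖x‖ ≤ N → ‖y‖ ≤ N → ‖Dg t x - Dg t y‖ ≤ M * ‖x - y‖ ^ δ

/-- A path of finite `q`-variation solving the Young differential equation on `[a,b]`. -/
structure IsYoungSolution {E F : Type*} [NormedAddCommGroup E] [NormedSpace ℝ E]
    [NormedAddCommGroup F] [NormedSpace ℝ F] (a b : ℝ) (f : ℝ → F → F) (g : ℝ → F → E →L[ℝ] F)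
    (ω : ℝ → E) (q : ℝ) (x : ℝ → F) : Prop where
  cont : ContinuousOn x (Icc a b)
  finite : FinitePVar q x a b
  eq : ∀ t ∈ Icc a b,
    x t = x a + (∫ s in a..t, f s (x s)) + youngIntegral (fun s => g s (x s)) ω a t

namespace IsYoungSystem

variable {E F : Type*} [NormedAddCommGroup E] [NormedSpace ℝ E]
  [NormedAddCommGroup F] [NormedSpace ℝ F]
  {a b : ℝ} {f : ℝ → F → F} {g : ℝ → F → E →L[ℝ] F} {Dg : ℝ → F → F →L[ℝ] E →L[ℝ] F} {ω : ℝ → E}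
  {W : ℝ → ℝ → ℝ} {κ γ δ q : ℝ}

theorem intervalIntegrable_drift (hS : IsYoungSystem a b f g Dg ω W κ γ δ q) {x : ℝ → F}
    (hx : IsYoungSolution a b f g ω q x) {s t : ℝ} (hs : a ≤ s) (hst : s ≤ t) (ht : t ≤ b) :
    IntervalIntegrable (fun r => f r (x r)) MeasureTheory.volume s t := by
  refine ContinuousOn.intervalIntegrable_of_Icc hst ?_
  exact hS.f_cont.comp_continuousOn
    (continuousOn_id.prodMk (hx.cont.mono (Icc_subset_Icc hs ht)))

theorem increment_sub_young (hS : IsYoungSystem a b f g Dg ω W κ γ δ q) {x : ℝ → F}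
    (hx : IsYoungSolution a b f g ω q x) {s t : ℝ} (hs : a ≤ s) (hst : s ≤ t) (ht : t ≤ b) :
    x t - x s - (youngIntegral (fun s => g s (x s)) ω a t
      - youngIntegral (fun s => g s (x s)) ω a s) = ∫ r in s..t, f r (x r) := by
  have h := intervalIntegral.integral_add_adjacent_intervals
    (hS.intervalIntegrable_drift hx le_rfl hs (hst.trans ht))
    (hS.intervalIntegrable_drift hx hs hst ht)
  rw [hx.eq t ⟨hs.trans hst, ht⟩, hx.eq s ⟨hs, hst.trans ht⟩, ← h]
  abel

theorem norm_drift_le (hS : IsYoungSystem a b f g Dg ω W κ γ δ q) :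
    ∃ A : ℝ, 0 ≤ A ∧ ∀ x, IsYoungSolution a b f g ω q x → ∀ s t : ℝ, a ≤ s → s ≤ t → t ≤ b →
      ∀ M : ℝ, (∀ r ∈ Icc s t, ‖x r‖ ≤ M) → ‖∫ r in s..t, f r (x r)‖ ≤ A * (1 + M) * W s t := by
  obtain ⟨A, hA, B, hB, hBW, hf⟩ := hS.f_growth
  refine ⟨A + 1, by positivity, fun x hx s t hs hst ht M hM => ?_⟩
  have hM0 : 0 ≤ M := (norm_nonneg _).trans (hM s ⟨le_rfl, hst⟩)
  have hB' : IntervalIntegrable B MeasureTheory.volume s t := hB.mono_set (by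
    rw [uIcc_of_le hst, uIcc_of_le hS.le]; exact Icc_subset_Icc hs ht)
  have hnW := hS.superadd.nonneg s t hs hst ht
  calc ‖∫ r in s..t, f r (x r)‖ ≤ ∫ r in s..t, (A * M + B r) := by
        refine intervalIntegral.norm_integral_le_of_norm_le hst ?_
          (intervalIntegrable_const.add hB')
        refine Filter.Eventually.of_forall fun r hr => (hf r (x r)).trans ?_
        have := hM r ⟨hr.1.le, hr.2⟩
        gcongr
    _ = (t - s) * (A * M) + ∫ r in s..t, B r := by
        rw [intervalIntegral.integral_add intervalIntegrable_const hB',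
          intervalIntegral.integral_const, smul_eq_mul]
    _ ≤ W s t * (A * M) + W s t :=
        add_le_add (mul_le_mul_of_nonneg_right (hS.length s t hs hst ht) (by positivity))
          (hBW s t hs hst ht)
    _ ≤ (A + 1) * (1 + M) * W s t := by nlinarith [mul_nonneg hA hnW, mul_nonneg hM0 hnW]

theorem norm_diffusion_increment_le (hS : IsYoungSystem a b f g Dg ω W κ γ δ q) :
    ∃ c : ℝ, 0 ≤ c ∧ ∀ s t : ℝ, a ≤ s → s ≤ t → t ≤ b → ∀ x y,
      ‖g t x - g s y‖ ≤ c * ‖x - y‖ + c * W s t ^ κ := by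
  obtain ⟨L, hL, hg⟩ := hS.g_lip
  obtain ⟨H, hH, hgt⟩ := hS.g_time
  refine ⟨L + H, by positivity, fun s t hs hst ht x y => ?_⟩
  have n := Real.rpow_nonneg (hS.superadd.nonneg s t hs hst ht) κ
  have e : g t x - g s y = (g t x - g t y) + (g t y - g s y) := by abel
  rw [e]
  refine (norm_add_le _ _).trans (add_le_add ((hg t x y).trans ?_)
    ((hgt s t hs hst ht y).1.trans ?_))
  · gcongr; linarith
  · gcongr; linarith

/-- Qualitative regularity of a solution and of its Young integral. -/
theorem exists_germ_bound [ProperSpace F] (hS : IsYoungSystem a b f g Dg ω W κ γ δ q) {x : ℝ → F}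
    (hx : IsYoungSolution a b f g ω q x) :
    ∃ V C N, IsSuperadd a b V ∧ VanishesOnDiag a b V ∧ 0 ≤ C ∧ 0 ≤ N ∧
      (∀ s t : ℝ, a ≤ s → s ≤ t → t ≤ b →
        ‖youngIntegral (fun s => g s (x s)) ω a t - youngIntegral (fun s => g s (x s)) ω a s
          - g s (x s) (ω t - ω s)‖ ≤ C * V s t ^ (κ + γ)) ∧
      ∀ s t : ℝ, a ≤ s → s ≤ t → t ≤ b → ‖x t - x s‖ ≤ N * W s t ^ γ := by
  have hγ : 0 < γ := hS.κ_pos.trans_le hS.κ_le_γ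
  obtain ⟨v, hv, hxv⟩ := hx.finite.exists_monotoneOn hS.q_pos
  have hW₁ := hS.superadd.add (IsSuperadd.of_monotoneOn hv)
  set W₁ : ℝ → ℝ → ℝ := fun s t => W s t + (v t - v s) with hW₁def
  obtain ⟨c₀, hc₀, hg⟩ := hS.norm_diffusion_increment_le
  have hTn := hW₁.nonneg a b le_rfl hS.le le_rfl
  set T := W₁ a b with hT
  have hWW₁ : ∀ s t : ℝ, a ≤ s → s ≤ t → t ≤ b → W s t ≤ W₁ s t := fun s t hs hst ht => by
    have := (IsSuperadd.of_monotoneOn hv).nonneg s t hs hst ht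
    simp only [hW₁def]; linarith
  have hD : ∀ s t : ℝ, a ≤ s → s ≤ t → t ≤ b →
      ‖g t (x t) - g s (x s)‖ ≤ (c₀ * T ^ (1 / q - κ) + c₀) * W₁ s t ^ κ := by
    intro s t hs hst ht
    have n1 := hW₁.nonneg s t hs hst ht
    have n2 := hS.superadd.nonneg s t hs hst ht
    have n3 := (IsSuperadd.of_monotoneOn hv).nonneg s t hs hst ht
    have e1 : ‖x t - x s‖ ≤ T ^ (1 / q - κ) * W₁ s t ^ κ := by
      have h1 : ‖x t - x s‖ ≤ W₁ s t ^ (1 / q) := by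
        have h := Real.rpow_le_rpow (Real.rpow_nonneg (norm_nonneg _) q)
          ((hxv s t hs hst ht).trans (le_add_of_nonneg_left n2))
          (one_div_nonneg.2 hS.q_pos.le)
        rwa [one_div, Real.rpow_rpow_inv (norm_nonneg _) hS.q_pos.ne', ← one_div] at h
      exact h1.trans (Real.rpow_le_rpow_sub_mul_rpow n1
        (hW₁.mono le_rfl hs hst ht le_rfl) hS.κ_pos hS.κ_le_inv)
    have e2 : W s t ^ κ ≤ W₁ s t ^ κ :=
      Real.rpow_le_rpow n2 (hWW₁ s t hs hst ht) hS.κ_pos.le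
    calc _ ≤ c₀ * ‖x t - x s‖ + c₀ * W s t ^ κ := hg s t hs hst ht _ _
      _ ≤ c₀ * (T ^ (1 / q - κ) * W₁ s t ^ κ) + c₀ * W₁ s t ^ κ := by gcongr
      _ = _ := by ring
  have hcn : 0 ≤ c₀ * T ^ (1 / q - κ) + c₀ := by positivity
  obtain ⟨V, hV, hV', hVpow, hI⟩ := youngIntegral_estimate (D := fun s => g s (x s)) hS.le hW₁
    hS.superadd hS.vanish hS.κ_pos hγ hS.one_lt hcn hD hS.driver
  have hK := sewConst_pos hS.one_lt
  obtain ⟨A, hA, hf⟩ := hS.norm_drift_le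
  obtain ⟨M, hM⟩ := (isCompact_Icc (a := a) (b := b)).exists_bound_of_continuousOn hx.cont
  have hM0 : 0 ≤ M := (norm_nonneg _).trans (hM a ⟨le_rfl, hS.le⟩)
  have hgc : ContinuousOn (fun s => g s (x s)) (Icc a b) :=
    hS.g_cont.comp_continuousOn (continuousOn_id.prodMk hx.cont)
  obtain ⟨G, hG⟩ := (isCompact_Icc (a := a) (b := b)).exists_bound_of_continuousOn hgc
  have hG0 : 0 ≤ G := (norm_nonneg _).trans (hG a ⟨le_rfl, hS.le⟩)
  have hWT := hS.superadd.nonneg a b le_rfl hS.le le_rfl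
  refine ⟨V, sewConst (κ + γ) * (c₀ * T ^ (1 / q - κ) + c₀),
    A * (1 + M) * W a b ^ (1 - γ)
      + sewConst (κ + γ) * (c₀ * T ^ (1 / q - κ) + c₀) * T ^ κ + G,
    hV, hV', by positivity, by positivity, hI, fun s t hs hst ht => ?_⟩
  have e1 := hI s t hs hst ht
  rw [hVpow s t hs hst ht] at e1
  have e2 := hf x hx s t hs hst ht M fun r hr => hM r ⟨hs.trans hr.1, hr.2.trans ht⟩
  rw [← hS.increment_sub_young hx hs hst ht] at e2
  have n2 := hS.superadd.nonneg s t hs hst ht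
  have e3 : W s t ≤ W a b ^ (1 - γ) * W s t ^ γ := by
    simpa using Real.rpow_le_rpow_sub_mul_rpow n2
      (hS.superadd.mono le_rfl hs hst ht le_rfl) hγ hS.γ_le_one
  have e4 : W₁ s t ^ κ ≤ T ^ κ := Real.rpow_le_rpow (hW₁.nonneg s t hs hst ht)
    (hW₁.mono le_rfl hs hst ht le_rfl) hS.κ_pos.le
  have e5 : ‖g s (x s) (ω t - ω s)‖ ≤ G * W s t ^ γ :=
    (ContinuousLinearMap.le_opNorm _ _).trans (mul_le_mul (hG s ⟨hs, hst.trans ht⟩)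
      (hS.driver s t hs hst ht) (norm_nonneg _) hG0)
  have e6 : x t - x s = (x t - x s - (youngIntegral (fun s => g s (x s)) ω a t
      - youngIntegral (fun s => g s (x s)) ω a s))
      + (youngIntegral (fun s => g s (x s)) ω a t - youngIntegral (fun s => g s (x s)) ω a s
          - g s (x s) (ω t - ω s)) + g s (x s) (ω t - ω s) := by abel
  have n3 := Real.rpow_nonneg n2 γ
  calc ‖x t - x s‖ ≤ A * (1 + M) * W s t
        + sewConst (κ + γ) * (c₀ * T ^ (1 / q - κ) + c₀) * (W₁ s t ^ κ * W s t ^ γ)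
        + G * W s t ^ γ := by
        rw [e6]
        exact (norm_add_le _ _).trans (add_le_add ((norm_add_le _ _).trans
          (add_le_add e2 e1)) e5)
    _ ≤ A * (1 + M) * (W a b ^ (1 - γ) * W s t ^ γ)
        + sewConst (κ + γ) * (c₀ * T ^ (1 / q - κ) + c₀) * (T ^ κ * W s t ^ γ)
        + G * W s t ^ γ := by gcongr
    _ = _ := by ring

/-- A length below which the constant `c` is absorbed by the control. -/
theorem exists_small_length (hS : IsYoungSystem a b f g Dg ω W κ γ δ q) (c : ℝ) :
    ∃ ε : ℝ, 0 < ε ∧ ε ≤ 1 ∧ 2 * (2 + sewConst (κ + γ)) * c * ε ^ κ ≤ 1 / 2 ∧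
      ∃ η : ℝ, 0 < η ∧ ∀ s t : ℝ, a ≤ s → s ≤ t → t ≤ b → t - s < η → W s t ≤ ε := by
  have hK := sewConst_pos hS.one_lt
  have h1 : ContinuousAt (fun ε : ℝ => 2 * (2 + sewConst (κ + γ)) * c * ε ^ κ) 0 :=
    (Real.continuousAt_rpow_const 0 κ (Or.inr hS.κ_pos.le)).const_mul _
  have h2 : ∀ᶠ ε in nhds (0 : ℝ), 2 * (2 + sewConst (κ + γ)) * c * ε ^ κ < 1 / 2 := by
    refine h1.eventually_lt continuousAt_const ?_
    rw [Real.zero_rpow hS.κ_pos.ne']; norm_num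
  obtain ⟨ε₀, hε₀, h3⟩ := Metric.eventually_nhds_iff.1 h2
  have hε : 0 < min 1 (ε₀ / 2) := by positivity
  refine ⟨min 1 (ε₀ / 2), hε, min_le_left _ _, (h3 ?_).le, hS.vanish _ hε⟩
  rw [dist_zero_right, Real.norm_of_nonneg hε.le]
  linarith [min_le_right 1 (ε₀ / 2)]

theorem local_growth [ProperSpace F] (hS : IsYoungSystem a b f g Dg ω W κ γ δ q) :
    ∃ A : ℝ, 0 ≤ A ∧ ∃ η : ℝ, 0 < η ∧ ∀ x, IsYoungSolution a b f g ω q x →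
      ∀ s t : ℝ, a ≤ s → s ≤ t → t ≤ b → t - s < η →
        ‖x t - x s‖ ≤ A * (1 + ‖x s‖) * W s t ^ γ ∧
        ‖x t - x s‖ ≤ 1 / 2 * (1 + ‖x s‖) ∧ ‖x t - x s‖ ≤ 1 / 2 * (1 + ‖x t‖) := by
  have hγ : 0 < γ := hS.κ_pos.trans_le hS.κ_le_γ
  have hK := sewConst_pos hS.one_lt
  obtain ⟨c₀, hc₀, hg⟩ := hS.norm_diffusion_increment_le
  obtain ⟨A, hA, hf⟩ := hS.norm_drift_le
  have hgc : ContinuousOn (fun s => g s 0) (Icc a b) :=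
    hS.g_cont.comp_continuousOn (continuousOn_id.prodMk continuousOn_const)
  obtain ⟨G, hG⟩ := (isCompact_Icc (a := a) (b := b)).exists_bound_of_continuousOn hgc
  have hG0 : 0 ≤ G := (norm_nonneg _).trans (hG a ⟨le_rfl, hS.le⟩)
  have hc : 0 ≤ A + G + c₀ := by positivity
  obtain ⟨ε, hε, hε1, hεc, η, hη, hWη⟩ := hS.exists_small_length (A + G + c₀)
  refine ⟨2 * (2 + sewConst (κ + γ)) * (A + G + c₀), by positivity, η, hη,
    fun x hx s t hs hst ht hd => ?_⟩
  obtain ⟨V, C, N, hV, hV', hC, hN, hI, hxN⟩ := hS.exists_germ_bound hx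
  have hM0 : ∀ {M : ℝ}, (∀ r : ℝ, s ≤ r → r ≤ t → ‖x r‖ ≤ M) → 0 ≤ M := fun {M} hM =>
    (norm_nonneg _).trans (hM s le_rfl hst)
  have key := fun r hr hr' => affine_young_estimate (D := fun s => g s (x s)) (r := r) (s := s)
    (t := t) (e := 1)
    (hV.restrict hs ht) (hV'.restrict hs ht) (hS.superadd.restrict hs ht)
    (hS.vanish.restrict hs ht) hS.κ_pos hS.κ_le_γ hS.γ_le_one hS.one_lt hc hC zero_le_one hε hε1
    (hWη s t hs hst ht hd) hεc (fun u v hu huv hv => hI u v (hs.trans hu) huv (hv.trans ht))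
    (fun u v hu huv hv => hS.driver u v (hs.trans hu) huv (hv.trans ht)) hN
    (fun u v hu huv hv => hxN u v (hs.trans hu) huv (hv.trans ht))
    (fun M hM u v hu huv hv => by
      rw [hS.increment_sub_young hx (hs.trans hu) huv (hv.trans ht)]
      have n := hS.superadd.nonneg u v (hs.trans hu) huv (hv.trans ht)
      have := hM0 hM
      refine (hf x hx u v (hs.trans hu) huv (hv.trans ht) M
        fun r hr => hM r (hu.trans hr.1) (hr.2.trans hv)).trans ?_
      gcongr
      linarith)
    (fun M hM r hr hr' => by
      have h0 := hM0 hM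
      have h1 := hg r r (hs.trans hr) le_rfl (hr'.trans ht) (x r) 0
      rw [hS.superadd.diag (hs.trans hr) (hr'.trans ht), Real.zero_rpow hS.κ_pos.ne', mul_zero,
        add_zero, sub_zero] at h1
      have h2 := hG r ⟨hs.trans hr, hr'.trans ht⟩
      have h3 := norm_add_le (g r (x r) - g r 0) (g r 0)
      rw [sub_add_cancel] at h3
      have h4 := mul_le_mul_of_nonneg_left (hM r hr hr') hc₀
      nlinarith [mul_nonneg hA h0, mul_nonneg hG0 h0])
    (fun M N hN hM hxN u v hu huv hv => by
      have h0 := hM0 hM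
      have n := hS.superadd.nonneg u v (hs.trans hu) huv (hv.trans ht)
      have nκ := Real.rpow_nonneg n κ
      have hW1 : W u v ≤ 1 := ((hS.superadd.mono hs hu huv hv ht).trans
        (hWη s t hs hst ht hd)).trans hε1
      have hp : W u v ^ γ ≤ W u v ^ κ :=
        Real.rpow_le_rpow_of_exponent_ge' n hW1 hS.κ_pos.le hS.κ_le_γ
      calc ‖g v (x v) - g u (x u)‖ ≤ c₀ * ‖x v - x u‖ + c₀ * W u v ^ κ :=
            hg u v (hs.trans hu) huv (hv.trans ht) _ _
        _ ≤ c₀ * (N * W u v ^ κ) + c₀ * W u v ^ κ := by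
            have := hxN u v hu huv hv
            gcongr
            exact this.trans (by gcongr)
        _ = c₀ * (1 + 0 + N) * W u v ^ κ := by ring
        _ ≤ (A + G + c₀) * (1 + M + N) * W u v ^ κ := by
            gcongr
            linarith)
    hr hr' le_rfl hst le_rfl
  exact ⟨(key s le_rfl hst).1, (key s le_rfl hst).2, (key t hst le_rfl).2⟩

end IsYoungSystem

namespace IsYoungSystem

variable {E F : Type*} [NormedAddCommGroup E] [NormedSpace ℝ E]
  [NormedAddCommGroup F] [NormedSpace ℝ F]
  {a b : ℝ} {f : ℝ → F → F} {g : ℝ → F → E →L[ℝ] F} {Dg : ℝ → F → F →L[ℝ] E →L[ℝ] F} {ω : ℝ → E}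
  {W : ℝ → ℝ → ℝ} {κ γ δ q : ℝ}

theorem norm_drift_sub_le (hS : IsYoungSystem a b f g Dg ω W κ γ δ q) {R : ℝ} (hR : 0 ≤ R) :
    ∃ L : ℝ, 0 ≤ L ∧ ∀ x y, IsYoungSolution a b f g ω q x → IsYoungSolution a b f g ω q y →
      (∀ r ∈ Icc a b, ‖x r‖ ≤ R) → (∀ r ∈ Icc a b, ‖y r‖ ≤ R) →
      ∀ s t : ℝ, a ≤ s → s ≤ t → t ≤ b → ∀ M : ℝ, (∀ r ∈ Icc s t, ‖x r - y r‖ ≤ M) →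
        ‖(∫ r in s..t, f r (x r)) - ∫ r in s..t, f r (y r)‖ ≤ L * M * W s t := by
  obtain ⟨L, hL, hf⟩ := hS.f_lip R hR
  refine ⟨L, hL, fun x y hx hy hxR hyR s t hs hst ht M hM => ?_⟩
  have hM0 : 0 ≤ M := (norm_nonneg _).trans (hM s ⟨le_rfl, hst⟩)
  rw [← intervalIntegral.integral_sub (hS.intervalIntegrable_drift hx hs hst ht)
    (hS.intervalIntegrable_drift hy hs hst ht)]
  have h := intervalIntegral.norm_integral_le_of_norm_le_const (a := s) (b := t) (C := L * M)
    (f := fun r => f r (x r) - f r (y r)) (fun r hr => by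
      rw [uIoc_of_le hst] at hr
      have hr' : r ∈ Icc a b := ⟨hs.trans hr.1.le, hr.2.trans ht⟩
      exact (hf r _ _ (hxR r hr') (hyR r hr')).trans
        (mul_le_mul_of_nonneg_left (hM r ⟨hr.1.le, hr.2⟩) hL))
  rw [abs_of_nonneg (sub_nonneg.2 hst)] at h
  exact h.trans (mul_le_mul_of_nonneg_left (hS.length s t hs hst ht) (by positivity))

theorem norm_diffusion_four_point_le (hS : IsYoungSystem a b f g Dg ω W κ γ δ q) {R N : ℝ}
    (hR : 0 ≤ R) (hN : 0 ≤ N) :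
    ∃ c : ℝ, 0 ≤ c ∧ (∀ r u v, ‖g r u - g r v‖ ≤ c * ‖u - v‖) ∧
      ∀ s t : ℝ, a ≤ s → s ≤ t → t ≤ b → W s t ≤ 1 → ∀ x y x' y',
      ‖x‖ ≤ R → ‖y‖ ≤ R → ‖x'‖ ≤ R → ‖y'‖ ≤ R → ‖x' - x‖ ≤ N * W s t ^ γ →
      ‖y' - y‖ ≤ N * W s t ^ γ →
      ‖g t x' - g t y' - (g s x - g s y)‖
        ≤ c * (‖x' - y'‖ + ‖x - y‖) * W s t ^ κ + c * ‖x' - y' - (x - y)‖ := by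
  obtain ⟨L, hL, hg⟩ := hS.g_lip
  obtain ⟨H, hH, hgt⟩ := hS.g_time
  obtain ⟨M, hM, hD⟩ := hS.Dg_holder R hR
  have hNδ : 0 ≤ N ^ δ := Real.rpow_nonneg hN _
  refine ⟨L + H + M * N ^ δ, by positivity, fun r u v => (hg r u v).trans ?_,
    fun s t hs hst ht hW1 x y x' y' hx hy hx' hy' hxx hyy => ?_⟩
  · gcongr
    nlinarith [mul_nonneg hM hNδ]
  have n := hS.superadd.nonneg s t hs hst ht
  have nκ := Real.rpow_nonneg n κ
  have hDL : ∀ z, ‖Dg s z‖ ≤ L := fun z =>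
    (hS.g_deriv s z).le_of_lip' hL (Filter.Eventually.of_forall fun w => hg s w z)
  have h := norm_four_point_le (hS.g_deriv t) (hS.g_deriv s) (R := R) hS.δ_pos.le hM
    (fun z => (hgt s t hs hst ht z).2) hDL (fun u v => hD s u v) hx hy hx' hy' hxx hyy
  have h2 : (N * W s t ^ γ) ^ δ ≤ N ^ δ * W s t ^ κ := by
    rw [Real.mul_rpow hN (Real.rpow_nonneg n _), ← Real.rpow_mul n]
    exact mul_le_mul_of_nonneg_left
      (Real.rpow_le_rpow_of_exponent_ge' n hW1 hS.κ_pos.le hS.κ_le_mul) hNδ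
  have hMN : 0 ≤ M * N ^ δ := mul_nonneg hM hNδ
  calc _ ≤ H * W s t ^ κ * ‖x' - y'‖ + L * ‖x' - y' - (x - y)‖
        + M * (N ^ δ * W s t ^ κ) * ‖x - y‖ := h.trans (by gcongr)
    _ = H * ‖x' - y'‖ * W s t ^ κ + M * N ^ δ * ‖x - y‖ * W s t ^ κ
        + L * ‖x' - y' - (x - y)‖ := by ring
    _ ≤ (L + H + M * N ^ δ) * ‖x' - y'‖ * W s t ^ κ
        + (L + H + M * N ^ δ) * ‖x - y‖ * W s t ^ κ
        + (L + H + M * N ^ δ) * ‖x' - y' - (x - y)‖ := by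
        gcongr
        · linarith
        · linarith
        · linarith
    _ = _ := by ring

theorem local_difference [ProperSpace F] (hS : IsYoungSystem a b f g Dg ω W κ γ δ q) {R : ℝ}
    (hR : 0 ≤ R) :
    ∃ η : ℝ, 0 < η ∧ ∀ x y, IsYoungSolution a b f g ω q x → IsYoungSolution a b f g ω q y →
      (∀ r ∈ Icc a b, ‖x r‖ ≤ R) → (∀ r ∈ Icc a b, ‖y r‖ ≤ R) →
      ∀ s t : ℝ, a ≤ s → s ≤ t → t ≤ b → t - s < η →
        ‖x t - y t - (x s - y s)‖ ≤ 1 / 2 * ‖x s - y s‖ ∧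
        ‖x t - y t - (x s - y s)‖ ≤ 1 / 2 * ‖x t - y t‖ := by
  have hγ : 0 < γ := hS.κ_pos.trans_le hS.κ_le_γ
  have hK := sewConst_pos hS.one_lt
  obtain ⟨A, hA, η₁, hη₁, hgrow⟩ := hS.local_growth
  have hN : 0 ≤ A * (1 + R) := by positivity
  obtain ⟨L, hL, hf⟩ := hS.norm_drift_sub_le hR
  obtain ⟨c₀, hc₀, hgl, hg⟩ := hS.norm_diffusion_four_point_le hR hN
  have hc : 0 ≤ L + 2 * c₀ := by positivity
  obtain ⟨ε, hε, hε1, hεc, η₂, hη₂, hWη⟩ := hS.exists_small_length (L + 2 * c₀)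
  refine ⟨min η₁ η₂, lt_min hη₁ hη₂, fun x y hx hy hxR hyR s t hs hst ht hd => ?_⟩
  have hd₁ : t - s < η₁ := hd.trans_le (min_le_left _ _)
  have hd₂ : t - s < η₂ := hd.trans_le (min_le_right _ _)
  obtain ⟨V, C, N, hV, hV', hC, hN, hI, hxN⟩ := hS.exists_germ_bound hx
  obtain ⟨V', C', N', hU, hU', hC', hN', hI', hyN⟩ := hS.exists_germ_bound hy
  have hM0 : ∀ {M : ℝ}, (∀ r : ℝ, s ≤ r → r ≤ t → ‖x r - y r‖ ≤ M) → 0 ≤ M := fun {M} hM =>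
    (norm_nonneg _).trans (hM s le_rfl hst)
  have hhol : ∀ z, IsYoungSolution a b f g ω q z → (∀ r ∈ Icc a b, ‖z r‖ ≤ R) →
      ∀ u v : ℝ, s ≤ u → u ≤ v → v ≤ t → ‖z v - z u‖ ≤ A * (1 + R) * W u v ^ γ := by
    intro z hz hzR u v hu huv hv
    refine (hgrow z hz u v (hs.trans hu) huv (hv.trans ht) (by linarith)).1.trans ?_
    have := hzR u ⟨hs.trans hu, huv.trans (hv.trans ht)⟩
    have := Real.rpow_nonneg (hS.superadd.nonneg u v (hs.trans hu) huv (hv.trans ht)) γ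
    gcongr
  have hθ0 : 0 ≤ κ + γ := by linarith [hS.one_lt]
  have key := fun r hr hr' => affine_young_estimate
    (D := fun s => g s (x s) - g s (y s)) (z := fun s => x s - y s)
    (I := fun t => youngIntegral (fun s => g s (x s)) ω a t
      - youngIntegral (fun s => g s (y s)) ω a t)
    (r := r) (s := s) (t := t) (e := 0) (C := C + C') (N₀ := N + N')
    ((hV.add hU).restrict hs ht) ((hV'.add hU').restrict hs ht) (hS.superadd.restrict hs ht)
    (hS.vanish.restrict hs ht) hS.κ_pos hS.κ_le_γ hS.γ_le_one hS.one_lt hc (by positivity)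
    le_rfl hε hε1 (hWη s t hs hst ht hd₂) hεc
    (fun u v hu huv hv => by
      have hu := hs.trans hu
      have hv := hv.trans ht
      have n1 := hV.nonneg u v hu huv hv
      have n2 := hU.nonneg u v hu huv hv
      have e : ∀ p p' q q' : F, ∀ l l' : E →L[ℝ] F, ∀ w : E,
          p - q - (p' - q') - (l - l') w = (p - p' - l w) - (q - q' - l' w) := by
        intro p p' q q' l l' w
        rw [sub_apply]; abel
      rw [e]
      calc _ ≤ C * V u v ^ (κ + γ) + C' * V' u v ^ (κ + γ) :=
            (norm_sub_le _ _).trans (add_le_add (hI u v hu huv hv) (hI' u v hu huv hv))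
        _ ≤ C * (V u v + V' u v) ^ (κ + γ) + C' * (V u v + V' u v) ^ (κ + γ) := by
            gcongr <;> linarith
        _ = _ := by ring)
    (fun u v hu huv hv => hS.driver u v (hs.trans hu) huv (hv.trans ht))
    (by positivity)
    (fun u v hu huv hv => by
      rw [sub_sub_sub_comm, add_mul]
      exact (norm_sub_le _ _).trans (add_le_add (hxN u v (hs.trans hu) huv (hv.trans ht))
        (hyN u v (hs.trans hu) huv (hv.trans ht))))
    (fun M hM u v hu huv hv => by
      have hu' := hs.trans hu
      have hv' := hv.trans ht
      have e : ∀ p p' q q' i i' j j' : F,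
          p - q - (p' - q') - (i - j - (i' - j')) = p - p' - (i - i') - (q - q' - (j - j')) := by
        intros; abel
      rw [e, hS.increment_sub_young hx hu' huv hv', hS.increment_sub_young hy hu' huv hv']
      have n := hS.superadd.nonneg u v hu' huv hv'
      have := hM0 hM
      refine (hf x y hx hy hxR hyR u v hu' huv hv' M
        fun r hr => hM r (hu.trans hr.1) (hr.2.trans hv)).trans ?_
      gcongr <;> linarith)
    (fun M hM r hr hr' => by
      have h0 := hM0 hM
      refine (hgl r (x r) (y r)).trans ?_
      have := hM r hr hr'
      gcongr <;> linarith)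
    (fun M N hN hM hzN u v hu huv hv => by
      have h0 := hM0 hM
      have hu' := hs.trans hu
      have hv' := hv.trans ht
      have n := hS.superadd.nonneg u v hu' huv hv'
      have nκ := Real.rpow_nonneg n κ
      have hW1 : W u v ≤ 1 := ((hS.superadd.mono hs hu huv hv ht).trans
        (hWη s t hs hst ht hd₂)).trans hε1
      have hp : W u v ^ γ ≤ W u v ^ κ :=
        Real.rpow_le_rpow_of_exponent_ge' n hW1 hS.κ_pos.le hS.κ_le_γ
      have mu : u ∈ Icc a b := ⟨hu', huv.trans hv'⟩
      have mv : v ∈ Icc a b := ⟨hu'.trans huv, hv'⟩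
      have h := hg u v hu' huv hv' hW1 (x u) (y u) (x v) (y v) (hxR u mu) (hyR u mu) (hxR v mv)
        (hyR v mv) (hhol x hx hxR u v hu huv hv) (hhol y hy hyR u v hu huv hv)
      calc _ ≤ c₀ * (M + M) * W u v ^ κ + c₀ * (N * W u v ^ κ) := by
            refine h.trans ?_
            have h1 := hM u hu (huv.trans hv)
            have h2 := hM v (hu.trans huv) hv
            have h3 := (hzN u v hu huv hv).trans (mul_le_mul_of_nonneg_left hp hN)
            gcongr
        _ = (c₀ * (M + M) + c₀ * N) * W u v ^ κ := by ring
        _ ≤ (L + 2 * c₀) * (0 + M + N) * W u v ^ κ := by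
            gcongr
            nlinarith [mul_nonneg hL h0, mul_nonneg hL hN, mul_nonneg hc₀ hN])
    hr hr' le_rfl hst le_rfl
  have k1 := (key s le_rfl hst).2
  have k2 := (key t hst le_rfl).2
  rw [zero_add] at k1 k2
  exact ⟨k1, k2⟩

end IsYoungSystem

/-- A local comparison in both time directions propagates to a global one. -/
theorem exists_global_bound {a b η : ℝ} (hη : 0 < η) : ∃ C : ℝ, 1 ≤ C ∧ ∀ φ : ℝ → ℝ,
    (∀ s ∈ Icc a b, 0 ≤ φ s) →
    (∀ s ∈ Icc a b, ∀ t ∈ Icc a b, |t - s| < η → φ s ≤ 2 * φ t) →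
    ∀ s ∈ Icc a b, ∀ t ∈ Icc a b, φ s ≤ C * φ t := by
  obtain ⟨n, hn⟩ := exists_nat_gt ((b - a) / (η / 2))
  refine ⟨2 ^ n, one_le_pow₀ one_le_two, fun φ h0 h => ?_⟩
  have key : ∀ k : ℕ, ∀ s ∈ Icc a b, ∀ t ∈ Icc a b, |t - s| ≤ k * (η / 2) →
      φ s ≤ 2 ^ k * φ t := by
    intro k
    induction k with
    | zero =>
      intro s hs t ht hd
      have hts : t = s := by simpa [sub_eq_zero] using hd
      simp [hts]
    | succ k ih =>
      intro s hs t ht hd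
      push_cast at hd
      have hk : 0 < (k : ℝ) + 1 := by positivity
      set r : ℝ := s + (1 / ((k : ℝ) + 1)) * (t - s) with hr
      have hl : 0 ≤ 1 / ((k : ℝ) + 1) := by positivity
      have hl1 : 1 / ((k : ℝ) + 1) ≤ 1 := by rw [div_le_one hk]; linarith [k.cast_nonneg (α := ℝ)]
      have hrm : r ∈ Icc a b := (convex_Icc a b).add_smul_sub_mem hs ht ⟨hl, hl1⟩
      have d1 : |r - s| < η := by
        rw [hr, add_sub_cancel_left, abs_mul, abs_of_nonneg hl]
        calc _ ≤ 1 / ((k : ℝ) + 1) * (((k : ℝ) + 1) * (η / 2)) := by gcongr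
          _ = η / 2 := by field_simp
          _ < η := by linarith
      have d2 : |t - r| ≤ k * (η / 2) := by
        have e : t - r = (k / ((k : ℝ) + 1)) * (t - s) := by rw [hr]; field_simp; ring
        rw [e, abs_mul, abs_of_nonneg (by positivity)]
        calc _ ≤ k / ((k : ℝ) + 1) * (((k : ℝ) + 1) * (η / 2)) := by gcongr
          _ = _ := by field_simp
      have := h s hs r hrm d1
      have := ih r hrm t ht d2
      rw [pow_succ]
      linarith
  intro s hs t ht
  have h1 : |t - s| ≤ n * (η / 2) := by
    have h2 : |t - s| ≤ b - a := by
      rw [abs_le]; constructor <;> linarith [hs.1, hs.2, ht.1, ht.2]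
    have h3 := (div_lt_iff₀ (by positivity : 0 < η / 2)).1 hn
    linarith
  exact key n s hs t ht h1

namespace IsYoungSystem

variable {E F : Type*} [NormedAddCommGroup E] [NormedSpace ℝ E]
  [NormedAddCommGroup F] [NormedSpace ℝ F] [ProperSpace F]
  {a b : ℝ} {f : ℝ → F → F} {g : ℝ → F → E →L[ℝ] F} {Dg : ℝ → F → F →L[ℝ] E →L[ℝ] F} {ω : ℝ → E}
  {W : ℝ → ℝ → ℝ} {κ γ δ q : ℝ}

theorem global_growth (hS : IsYoungSystem a b f g Dg ω W κ γ δ q) :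
    ∃ C : ℝ, 1 ≤ C ∧ ∀ x, IsYoungSolution a b f g ω q x →
      ∀ s ∈ Icc a b, ∀ t ∈ Icc a b, 1 + ‖x s‖ ≤ C * (1 + ‖x t‖) := by
  obtain ⟨A, -, η, hη, h⟩ := hS.local_growth
  obtain ⟨C, hC, hglob⟩ := exists_global_bound (a := a) (b := b) hη
  refine ⟨C, hC, fun x hx => hglob (fun s => 1 + ‖x s‖) (fun s _ => by positivity)
    fun s hs t ht hd => ?_⟩
  rw [abs_lt] at hd
  have h1 := norm_sub_norm_le (x s) (x t)
  have h0 := norm_nonneg (x t)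
  rcases le_total s t with hst | hst
  · have := (h x hx s t hs.1 hst ht.2 hd.2).2.2
    rw [norm_sub_rev] at this
    linarith
  · have := (h x hx t s ht.1 hst hs.2 (by linarith [hd.1])).2.1
    linarith

theorem global_difference (hS : IsYoungSystem a b f g Dg ω W κ γ δ q) {R : ℝ} (hR : 0 ≤ R) :
    ∃ C : ℝ, 1 ≤ C ∧ ∀ x y, IsYoungSolution a b f g ω q x → IsYoungSolution a b f g ω q y →
      (∀ r ∈ Icc a b, ‖x r‖ ≤ R) → (∀ r ∈ Icc a b, ‖y r‖ ≤ R) →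
      ∀ s ∈ Icc a b, ∀ t ∈ Icc a b, ‖x s - y s‖ ≤ C * ‖x t - y t‖ := by
  obtain ⟨η, hη, h⟩ := hS.local_difference hR
  obtain ⟨C, hC, hglob⟩ := exists_global_bound (a := a) (b := b) hη
  refine ⟨C, hC, fun x y hx hy hxR hyR => hglob (fun s => ‖x s - y s‖)
    (fun s _ => norm_nonneg _) fun s hs t ht hd => ?_⟩
  rw [abs_lt] at hd
  have h1 := norm_sub_norm_le (x s - y s) (x t - y t)
  have h0 := norm_nonneg (x t - y t)
  rcases le_total s t with hst | hst
  · have := (h x y hx hy hxR hyR s t hs.1 hst ht.2 hd.2).2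
    rw [norm_sub_rev] at this
    linarith
  · have := (h x y hx hy hxR hyR t s ht.1 hst hs.2 (by linarith [hd.1])).1
    linarith

end IsYoungSystem

/-- A local perturbation of the identity maps neighbourhoods to neighbourhoods. -/
theorem image_mem_nhds_of_norm_sub_le {F : Type*} [NormedAddCommGroup F] [NormedSpace ℝ F]
    [CompleteSpace F] {G : F → F} {s : Set F} {x : F} (hs : s ∈ nhds x)
    (hG : ∀ y ∈ s, ∀ y' ∈ s, ‖G y - G y' - (y - y')‖ ≤ 1 / 2 * ‖y - y'‖) :
    G '' s ∈ nhds (G x) := by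
  have h : ApproximatesLinearOn G (ContinuousLinearMap.id ℝ F) s (1 / 2) := fun y hy y' hy' => by
    simpa using hG y hy y' hy'
  let r : (ContinuousLinearMap.id ℝ F).NonlinearRightInverse :=
    { toFun := id, nnnorm := 1, bound' := fun y => by simp, right_inv' := fun y => by simp }
  refine h.image_mem_nhds r hs (Or.inr ?_)
  change (1 / 2 : NNReal) < 1⁻¹
  rw [inv_one]
  exact NNReal.half_lt_self one_ne_zero

namespace IsYoungSystem

variable {E F : Type*} [NormedAddCommGroup E] [NormedSpace ℝ E]
  [NormedAddCommGroup F] [NormedSpace ℝ F] [ProperSpace F]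
  {a b : ℝ} {f : ℝ → F → F} {g : ℝ → F → E →L[ℝ] F} {Dg : ℝ → F → F →L[ℝ] E →L[ℝ] F} {ω : ℝ → E}
  {W : ℝ → ℝ → ℝ} {κ γ δ q : ℝ}

theorem exists_uniform_bound (hS : IsYoungSystem a b f g Dg ω W κ γ δ q) (R₀ : ℝ) :
    ∃ R : ℝ, 0 ≤ R ∧ ∀ x, IsYoungSolution a b f g ω q x → ‖x a‖ ≤ R₀ →
      ∀ r ∈ Icc a b, ‖x r‖ ≤ R := by
  obtain ⟨C, hC, h⟩ := hS.global_growth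
  refine ⟨max 0 (C * (1 + R₀)), le_max_left _ _, fun x hx hxa r hr => le_max_of_le_right ?_⟩
  have h1 := h x hx r hr a ⟨le_rfl, hS.le⟩
  have h2 : C * (1 + ‖x a‖) ≤ C * (1 + R₀) := by gcongr
  linarith

variable {Φ : F → ℝ → F}

theorem continuous_flow (hS : IsYoungSystem a b f g Dg ω W κ γ δ q)
    (hΦ : ∀ z, IsYoungSolution a b f g ω q (Φ z)) (h0 : ∀ z, Φ z a = z) {t : ℝ}
    (ht : t ∈ Icc a b) : Continuous (fun z => Φ z t) := by
  refine continuous_iff_continuousAt.2 fun z₀ => ?_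
  obtain ⟨R, hR, hbd⟩ := hS.exists_uniform_bound (‖z₀‖ + 1)
  obtain ⟨C, hC, h⟩ := hS.global_difference hR
  refine continuousAt_of_locally_lipschitz (K := C) zero_lt_one fun z hz => ?_
  rw [dist_eq_norm] at hz ⊢
  rw [dist_eq_norm]
  have hz' : ‖z‖ ≤ ‖z₀‖ + 1 := by linarith [norm_sub_norm_le z z₀]
  have h1 := h _ _ (hΦ z) (hΦ z₀) (hbd _ (hΦ z) (by rwa [h0]))
    (hbd _ (hΦ z₀) (by rw [h0]; linarith)) t ht a ⟨le_rfl, hS.le⟩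
  rwa [h0, h0] at h1

theorem injective_flow (hS : IsYoungSystem a b f g Dg ω W κ γ δ q)
    (hΦ : ∀ z, IsYoungSolution a b f g ω q (Φ z)) (h0 : ∀ z, Φ z a = z) {t : ℝ}
    (ht : t ∈ Icc a b) : Function.Injective (fun z => Φ z t) := by
  intro z y hzy
  obtain ⟨R, hR, hbd⟩ := hS.exists_uniform_bound (max ‖z‖ ‖y‖)
  obtain ⟨C, hC, h⟩ := hS.global_difference hR
  have h1 := h _ _ (hΦ z) (hΦ y) (hbd _ (hΦ z) (by rw [h0]; exact le_max_left _ _))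
    (hbd _ (hΦ y) (by rw [h0]; exact le_max_right _ _)) a ⟨le_rfl, hS.le⟩ t ht
  simp only at hzy
  rw [hzy, sub_self, norm_zero, mul_zero, h0, h0] at h1
  exact sub_eq_zero.1 (norm_le_zero_iff.1 h1)

theorem image_flow_mem_nhds (hS : IsYoungSystem a b f g Dg ω W κ γ δ q)
    (hΦ : ∀ z, IsYoungSolution a b f g ω q (Φ z)) (h0 : ∀ z, Φ z a = z) (z₀ : F) {t : ℝ}
    (ht : t ∈ Icc a b) {U : Set F} (hU : U ∈ nhds z₀) :
    (fun z => Φ z t) '' U ∈ nhds (Φ z₀ t) := by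
  obtain ⟨R, hR, hbd⟩ := hS.exists_uniform_bound (‖z₀‖ + 1)
  obtain ⟨η, hη, hloc⟩ := hS.local_difference hR
  have hb : ∀ z ∈ Metric.ball z₀ 1, ∀ r ∈ Icc a b, ‖Φ z r‖ ≤ R := fun z hz => by
    refine hbd _ (hΦ z) ?_
    rw [mem_ball_iff_norm] at hz
    rw [h0]
    linarith [norm_sub_norm_le z z₀]
  have key : ∀ k : ℕ, ∀ t ∈ Icc a b, t - a ≤ k * (η / 2) → ∀ U ∈ nhds z₀,
      (fun z => Φ z t) '' U ∈ nhds (Φ z₀ t) := by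
    intro k
    induction k with
    | zero =>
      intro t ht htk U hU
      have : t = a := le_antisymm (by simpa using htk) ht.1
      subst this
      simpa [h0] using hU
    | succ k ih =>
      intro t ht htk U hU
      push_cast at htk
      obtain ⟨s, hs, hst, hsk, hd⟩ : ∃ s, a ≤ s ∧ s ≤ t ∧ s - a ≤ k * (η / 2) ∧ t - s < η := by
        refine ⟨max a (t - η / 2), le_max_left _ _, max_le ht.1 (by linarith), ?_, ?_⟩
        · rw [← sub_nonneg]
          rcases max_choice a (t - η / 2) with h | h <;> rw [h]
          · rw [sub_self, sub_zero]; positivity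
          · linarith
        · linarith [le_max_right a (t - η / 2)]
      have hU' : U ∩ Metric.ball z₀ 1 ∈ nhds z₀ :=
        Filter.inter_mem hU (Metric.ball_mem_nhds _ one_pos)
      have hSn := ih s ⟨hs, hst.trans ht.2⟩ hsk _ hU'
      set S := (fun z => Φ z s) '' (U ∩ Metric.ball z₀ 1) with hSdef
      choose! ψ hψ using fun y (hy : y ∈ S) => hy
      have hG := image_mem_nhds_of_norm_sub_le (G := fun y => Φ (ψ y) t) hSn
        fun y hy y' hy' => by
          have h1 := (hloc _ _ (hΦ (ψ y)) (hΦ (ψ y')) (hb _ (hψ y hy).1.2)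
            (hb _ (hψ y' hy').1.2) s t hs hst ht.2 hd).1
          have e1 : Φ (ψ y) s = y := (hψ y hy).2
          have e2 : Φ (ψ y') s = y' := (hψ y' hy').2
          rwa [e1, e2] at h1
      have hz : ψ (Φ z₀ s) = z₀ := hS.injective_flow hΦ h0 ⟨hs, hst.trans ht.2⟩
        (hψ _ (mem_of_mem_nhds hSn)).2
      simp only [hz] at hG
      refine Filter.mem_of_superset hG ?_
      rintro _ ⟨y, hy, rfl⟩
      exact ⟨ψ y, (hψ y hy).1.1, rfl⟩
  obtain ⟨n, hn⟩ := exists_nat_gt ((t - a) / (η / 2))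
  exact key n t ht ((div_lt_iff₀ (by positivity)).1 hn).le U hU

/-- The flow of a Young differential equation consists of homeomorphisms. -/
theorem isHomeomorph_flow (hS : IsYoungSystem a b f g Dg ω W κ γ δ q)
    (hΦ : ∀ z, IsYoungSolution a b f g ω q (Φ z)) (h0 : ∀ z, Φ z a = z) {t : ℝ}
    (ht : t ∈ Icc a b) : IsHomeomorph (fun z => Φ z t) := by
  have hcont := hS.continuous_flow hΦ h0 ht
  have hopen : IsOpenMap (fun z => Φ z t) := isOpenMap_iff_nhds_le.2 fun z U hU =>
    Filter.mem_of_superset (hS.image_flow_mem_nhds hΦ h0 z ht hU) (image_preimage_subset _ _)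
  obtain ⟨C, hC, hgrow⟩ := hS.global_growth
  have hproper : IsProperMap (fun z => Φ z t) := by
    refine isProperMap_iff_tendsto_cocompact.2 ⟨hcont, ?_⟩
    rw [← Metric.cobounded_eq_cocompact, ← tendsto_norm_atTop_iff_cobounded]
    refine Filter.tendsto_atTop.2 fun N => ?_
    filter_upwards [tendsto_norm_cobounded_atTop.eventually_ge_atTop (C * (1 + N))] with z hz
    have h1 := hgrow _ (hΦ z) a ⟨le_rfl, hS.le⟩ t ht
    rw [h0] at h1
    have h2 : C * (1 + N) ≤ C * (1 + ‖Φ z t‖) := by linarith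
    linarith [le_of_mul_le_mul_left h2 (by linarith)]
  refine ⟨hcont, hopen, hS.injective_flow hΦ h0 ht, range_eq_univ.1 ?_⟩
  exact IsClopen.eq_univ ⟨hproper.isClosedMap.isClosed_range, hopen.isOpen_range⟩
    (range_nonempty _)

end IsYoungSystem

theorem exists_young_exponents {p q β δ : ℝ} (hp1 : 1 < p) (hδ : p - 1 < δ) (hδ0 : 0 < δ)
    (hδ1 : δ ≤ 1) (hβ0 : 0 < β) (hβ : 1 - 1 / p < β) (hq : 1 - 1 / p < 1 / q)
    (hq' : 1 / q < 1 / p) :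
    ∃ κ γ : ℝ, 0 < κ ∧ κ ≤ γ ∧ κ ≤ γ * δ ∧ κ ≤ 1 / q ∧ κ ≤ β ∧ γ ≤ 1 ∧ γ < 1 / p ∧
      1 < κ + γ := by
  have hp0 : 0 < p := by linarith
  have hp : 1 / p < 1 := (div_lt_one hp0).2 hp1
  have h1 : max (1 / (1 + δ)) (max (1 - β) (1 - 1 / q)) < 1 / p :=
    max_lt (one_div_lt_one_div_of_lt hp0 (by linarith)) (max_lt (by linarith) (by linarith))
  obtain ⟨γ, hγ, hγp⟩ := exists_between h1
  have g1 : 1 / (1 + δ) < γ := (le_max_left _ _).trans_lt hγ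
  have g2 : 1 - β < γ := ((le_max_left _ _).trans (le_max_right _ _)).trans_lt hγ
  have g3 : 1 - 1 / q < γ := ((le_max_right _ _).trans (le_max_right _ _)).trans_lt hγ
  have g4 : 1 < γ * (1 + δ) := (div_lt_iff₀ (by linarith)).1 g1
  have hγ0 : 0 < γ := lt_trans (by positivity) g1
  have hκγ : min (1 / q) (min β (γ * δ)) ≤ γ * δ := (min_le_right _ _).trans (min_le_right _ _)
  refine ⟨min (1 / q) (min β (γ * δ)), γ, lt_min (by linarith) (lt_min hβ0 (by positivity)),
    hκγ.trans (mul_le_of_le_one_right hγ0.le hδ1), hκγ, min_le_left _ _,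
    (min_le_right _ _).trans (min_le_left _ _), by linarith, hγp, ?_⟩
  rw [← sub_lt_iff_lt_add]
  exact lt_min (by linarith) (lt_min (by linarith) (by linarith))

theorem le_one_add_rpow {u e : ℝ} (he : 1 ≤ e) : u ≤ 1 + |u| ^ e := by
  rcases le_total |u| 1 with h | h
  · linarith [le_abs_self u, Real.rpow_nonneg (abs_nonneg u) e]
  · linarith [le_abs_self u, Real.self_le_rpow_of_one_le h he]

theorem exists_isYoungSystem {d m : ℕ} {p : ℝ} (hp1 : 1 < p)
    {f : ℝ → Ed d → Ed d} {g : ℝ → Ed d → (Ed m →L[ℝ] Ed d)}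
    (hf : Continuous (fun pr : ℝ × Ed d => f pr.1 pr.2))
    (hg : Continuous (fun pr : ℝ × Ed d => g pr.1 pr.2))
    {Dg : ℝ → Ed d → (Ed d →L[ℝ] Ed m →L[ℝ] Ed d)}
    (hDg : ∀ (t : ℝ) (x : Ed d), HasFDerivAt (g t) (Dg t x) x)
    {β δ Lg : ℝ} (hβ0 : 0 < β) (hδ0 : 0 < δ) (hδ1 : δ ≤ 1) (hLg : 0 < Lg)
    {h : ℝ → ℝ → ℝ} {t1 t2 : ℝ} (ht12 : t1 ≤ t2) (hctrl : IsControlOn t1 t2 h)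
    {MN : ℝ → ℝ} (hMN : ∀ N : ℝ, 0 ≤ N → 0 < MN N)
    (H1i : ∀ (t : ℝ) (x y : Ed d), ‖g t x - g t y‖ ≤ Lg * ‖x - y‖)
    (H1ii : ∀ N : ℝ, 0 ≤ N → ∀ (t : ℝ) (x y : Ed d), ‖x‖ ≤ N → ‖y‖ ≤ N →
      ‖Dg t x - Dg t y‖ ≤ MN N * ‖x - y‖ ^ δ)
    (H1iii : ∀ s t : ℝ, s < t → ∀ x : Ed d,
      ‖g t x - g s x‖ + ‖Dg t x - Dg s x‖ ≤ h s t ^ β)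
    {a e : ℝ} {b : ℝ → ℝ} (ha : 0 < a) (he : 1 ≤ e)
    (hb : IntervalIntegrable (fun s => |b s| ^ e) MeasureTheory.volume t1 t2)
    {LN : ℝ → ℝ} (hLN : ∀ N : ℝ, 0 ≤ N → 0 < LN N)
    (H2i : ∀ N : ℝ, 0 ≤ N → ∀ (t : ℝ) (x y : Ed d), ‖x‖ ≤ N → ‖y‖ ≤ N →
      ‖f t x - f t y‖ ≤ LN N * ‖x - y‖)
    (H2ii : ∀ (t : ℝ) (x : Ed d), ‖f t x‖ ≤ a * ‖x‖ + b t)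
    (H3a : p - 1 < δ) (H3b : 1 - 1 / p < β) {q : ℝ}
    (hq : 1 - 1 / p < 1 / q) (hq' : 1 / q < 1 / p)
    {ω : ℝ → Ed m} (hω : Continuous ω) (hωp : FinitePVar p ω t1 t2) :
    ∃ W κ γ, IsYoungSystem t1 t2 f g Dg ω W κ γ δ q := by
  have hp0 : 0 < p := by linarith
  have hp : 1 / p < 1 := (div_lt_one hp0).2 hp1
  have hq0 : 0 < q := one_div_pos.1 (by linarith)
  obtain ⟨κ, γ, hκ, hκγ, hκγδ, hκq, hκβ, hγ1, hγp, hθ⟩ :=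
    exists_young_exponents hp1 H3a hδ0 hδ1 hβ0 H3b hq hq'
  have hγ : 0 < γ := hκ.trans_le hκγ
  obtain ⟨U, hU, hU', hUω⟩ := hωp.exists_vanishing_control hp0 hγ hγp ht12 hω.continuousOn
  set B : ℝ → ℝ := fun s => 1 + |b s| ^ e with hB
  have hBi : IntervalIntegrable B MeasureTheory.volume t1 t2 := intervalIntegrable_const.add hb
  have hB0 : ∀ s, 0 ≤ B s := fun s => by
    have := Real.rpow_nonneg (abs_nonneg (b s)) e
    simp only [hB]; linarith
  have hBst : ∀ s t : ℝ, t1 ≤ s → s ≤ t → t ≤ t2 →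
      (∫ r in t1..t, B r) - (∫ r in t1..s, B r) = ∫ r in s..t, B r := by
    intro s t hs hst ht
    refine intervalIntegral.integral_interval_sub_left (hBi.mono_set ?_) (hBi.mono_set ?_)
    · rw [uIcc_of_le (hs.trans hst), uIcc_of_le ht12]; exact Icc_subset_Icc le_rfl ht
    · rw [uIcc_of_le hs, uIcc_of_le ht12]; exact Icc_subset_Icc le_rfl (hst.trans ht)
  set v : ℝ → ℝ := fun t => t + ∫ r in t1..t, B r with hv
  have hvst : ∀ s t : ℝ, t1 ≤ s → s ≤ t → t ≤ t2 →
      v t - v s = (t - s) + ∫ r in s..t, B r := by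
    intro s t hs hst ht
    rw [← hBst s t hs hst ht, hv]; ring
  have hBint : ∀ s t : ℝ, s ≤ t → 0 ≤ ∫ r in s..t, B r := fun s t hst =>
    intervalIntegral.integral_nonneg hst fun r _ => hB0 r
  have hvm : MonotoneOn v (Icc t1 t2) := fun s hs t ht hst => by
    have := hvst s t hs.1 hst ht.2
    linarith [hBint s t hst]
  have hvc : ContinuousOn v (Icc t1 t2) := by
    refine continuousOn_id.add ?_
    have := intervalIntegral.continuousOn_primitive_interval' hBi left_mem_uIcc
    rwa [uIcc_of_le ht12] at this
  have hh := hctrl.isSuperadd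
  have hV := IsSuperadd.of_monotoneOn hvm
  have hW := (hU.add hh).add hV
  have hW' := (hU'.add hctrl.vanishesOnDiag).add (VanishesOnDiag.of_continuousOn hvc)
  set W : ℝ → ℝ → ℝ := fun s t => U s t + h s t + (v t - v s) with hWdef
  refine ⟨W, κ, γ, ?_⟩
  have hUW : ∀ s t : ℝ, t1 ≤ s → s ≤ t → t ≤ t2 → U s t ≤ W s t := fun s t hs hst ht => by
    have := hh.nonneg s t hs hst ht
    have := hV.nonneg s t hs hst ht
    simp only [hWdef]; linarith
  have hhW : ∀ s t : ℝ, t1 ≤ s → s ≤ t → t ≤ t2 → h s t ≤ W s t := fun s t hs hst ht => by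
    have := hU.nonneg s t hs hst ht
    have := hV.nonneg s t hs hst ht
    simp only [hWdef]; linarith
  have hvW : ∀ s t : ℝ, t1 ≤ s → s ≤ t → t ≤ t2 → v t - v s ≤ W s t := fun s t hs hst ht => by
    have := hU.nonneg s t hs hst ht
    have := hh.nonneg s t hs hst ht
    simp only [hWdef]; linarith
  have hWn := hW.nonneg t1 t2 le_rfl ht12 le_rfl
  exact
    { le := ht12
      superadd := hW
      vanish := hW'
      q_pos := hq0
      δ_pos := hδ0
      κ_pos := hκ
      κ_le_γ := hκγ
      κ_le_mul := hκγδ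
      κ_le_inv := hκq
      γ_le_one := hγ1
      one_lt := hθ
      driver := fun s t hs hst ht => (hUω s t hs hst ht).trans
        (Real.rpow_le_rpow (hU.nonneg s t hs hst ht) (hUW s t hs hst ht) hγ.le)
      length := fun s t hs hst ht => by
        linarith [hvW s t hs hst ht, hvst s t hs hst ht, hBint s t hst]
      f_cont := hf
      g_cont := hg
      f_growth := ⟨a, ha.le, B, hBi, fun s t hs hst ht => by
          linarith [hvW s t hs hst ht, hvst s t hs hst ht],
        fun t x => (H2ii t x).trans (by
          have := le_one_add_rpow (u := b t) he
          simp only [hB]; linarith)⟩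
      f_lip := fun N hN => ⟨LN N, (hLN N hN).le, H2i N hN⟩
      g_deriv := hDg
      g_lip := ⟨Lg, hLg.le, H1i⟩
      g_time := by
        refine ⟨W t1 t2 ^ (β - κ), Real.rpow_nonneg hWn _, fun s t hs hst ht x => ?_⟩
        have n := hW.nonneg s t hs hst ht
        rcases hst.eq_or_lt with rfl | hlt
        · have h1 := mul_nonneg (Real.rpow_nonneg hWn (β - κ)) (Real.rpow_nonneg n κ)
          exact ⟨(norm_sub_eq_zero_iff.2 rfl).trans_le h1,
            (ContinuousLinearMap.opNorm_le_bound _ le_rfl fun z => by simp).trans h1⟩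
        · have h1 := (H1iii s t hlt x).trans
            ((Real.rpow_le_rpow (hh.nonneg s t hs hst ht) (hhW s t hs hst ht) hβ0.le).trans
              (Real.rpow_le_rpow_sub_mul_rpow n (hW.mono le_rfl hs hst ht le_rfl) hκ hκβ))
          have h2 := norm_nonneg (g t x - g s x)
          have h3 := norm_nonneg (Dg t x - Dg s x)
          constructor <;> linarith
      Dg_holder := fun N hN => ⟨MN N, (hMN N hN).le, H1ii N hN⟩ }

/-- Theorem `cauchy.operator`: under (H1)–(H3) holding on every interval
with constants independent of the interval, and `ω ∈ C̃^p(ℝ,ℝ^m)`, any map `X : ℝ^d → ℝ^d`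
sending each initial value `z` at time `t1` to the value at time `t2` of the (unique) finite
`q`-variation solution of the Young equation on `[t1,t2]` is a homeomorphism of `ℝ^d`; and
if `t1 = t2` it is the identity. -/
theorem stmt18
    {d m : ℕ} (p : ℝ) (hp1 : 1 < p) (hp2 : p < 2)
    (f : ℝ → Ed d → Ed d) (g : ℝ → Ed d → (Ed m →L[ℝ] Ed d))
    (hf : Continuous (fun pr : ℝ × Ed d => f pr.1 pr.2))
    (hg : Continuous (fun pr : ℝ × Ed d => g pr.1 pr.2))
    (Dg : ℝ → Ed d → (Ed d →L[ℝ] Ed m →L[ℝ] Ed d))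
    (hDg : ∀ (t : ℝ) (x : Ed d), HasFDerivAt (g t) (Dg t x) x)
    (β δ Lg : ℝ) (hβ0 : 0 < β) (hβ1 : β ≤ 1) (hδ0 : 0 < δ) (hδ1 : δ ≤ 1) (hLg : 0 < Lg)
    (h : ℝ → ℝ → ℝ) (hctrl : ∀ S T1 : ℝ, S ≤ T1 → IsControlOn S T1 h)
    (MN : ℝ → ℝ) (hMN : ∀ N : ℝ, 0 ≤ N → 0 < MN N)
    (H1i : ∀ (t : ℝ) (x y : Ed d), ‖g t x - g t y‖ ≤ Lg * ‖x - y‖)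
    (H1ii : ∀ N : ℝ, 0 ≤ N → ∀ (t : ℝ) (x y : Ed d), ‖x‖ ≤ N → ‖y‖ ≤ N →
      ‖Dg t x - Dg t y‖ ≤ MN N * ‖x - y‖ ^ δ)
    (H1iii : ∀ s t : ℝ, s < t → ∀ x : Ed d,
      ‖g t x - g s x‖ + ‖Dg t x - Dg s x‖ ≤ h s t ^ β)
    (a α : ℝ) (b : ℝ → ℝ) (ha : 0 < a) (hα1 : 1 / 2 ≤ α) (hα2 : α < 1)
    (hbmem : ∀ S T1 : ℝ, S ≤ T1 →
      IntervalIntegrable (fun s => |b s| ^ (1 / (1 - α))) MeasureTheory.volume S T1)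
    (LN : ℝ → ℝ) (hLN : ∀ N : ℝ, 0 ≤ N → 0 < LN N)
    (H2i : ∀ N : ℝ, 0 ≤ N → ∀ (t : ℝ) (x y : Ed d), ‖x‖ ≤ N → ‖y‖ ≤ N →
      ‖f t x - f t y‖ ≤ LN N * ‖x - y‖)
    (H2ii : ∀ (t : ℝ) (x : Ed d), ‖f t x‖ ≤ a * ‖x‖ + b t)
    (H3a : p - 1 < δ) (H3b : 1 - 1 / p < β) (H3c : 1 - 1 / p < δ * α)
    (q0 q : ℝ)
    (hq0a : 1 - 1 / p < 1 / q0)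
    (hq0b : 1 / q0 < min (min β (δ * α)) (min (δ / p) (1 / 2)))
    (hqa : 1 / (q0 * δ) ≤ 1 / q) (hqb : 1 / q < min α (1 / p))
    (ω : ℝ → Ed m) (hω : Continuous ω)
    (hωp : ∀ s t : ℝ, s ≤ t → FinitePVar p ω s t)
    (t1 t2 : ℝ) (ht12 : t1 ≤ t2) (X : Ed d → Ed d)
    (hX : ∀ z : Ed d, ∃ x : ℝ → Ed d,
      ContinuousOn x (Set.Icc t1 t2) ∧ FinitePVar q x t1 t2 ∧ x t1 = z ∧
      (∀ t ∈ Set.Icc t1 t2,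
        x t = z + (∫ s in t1..t, f s (x s)) + youngIntegral (fun s => g s (x s)) ω t1 t) ∧
      X z = x t2) :
    IsHomeomorph X ∧ (t1 = t2 → X = id) := by
  have hp : 1 / p < 1 := (div_lt_one (by linarith)).2 hp1
  have hq : 1 - 1 / p < 1 / q := by
    refine lt_of_lt_of_le ?_ hqa
    rw [← div_div]
    exact hq0a.trans_le (le_div_self (by linarith) hδ0 hδ1)
  have he : 1 ≤ 1 / (1 - α) := by
    rw [le_div_iff₀ (by linarith)]
    linarith
  obtain ⟨W, κ, γ, hS⟩ := exists_isYoungSystem hp1 hf hg hDg hβ0 hδ0 hδ1 hLg ht12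
    (hctrl t1 t2 ht12) hMN H1i H1ii H1iii ha he (hbmem t1 t2 ht12) hLN H2i H2ii H3a H3b hq
    (hqb.trans_le (min_le_right _ _)) hω (hωp t1 t2 ht12)
  choose Φ hc hv h0 heq hXΦ using hX
  have hΦ : ∀ z, IsYoungSolution t1 t2 f g ω q (Φ z) := fun z =>
    ⟨hc z, hv z, fun t ht => by rw [h0 z]; exact heq z t ht⟩
  have hX' : X = fun z => Φ z t2 := funext hXΦ
  refine ⟨?_, fun h12 => ?_⟩
  · rw [hX']
    exact hS.isHomeomorph_flow hΦ h0 ⟨ht12, le_rfl⟩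
  · subst h12
    rw [hX']
    exact funext h0
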